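/- arXiv:0706.1101 — 3 statements merged into one kernel-verified Lean document; each statement's English description precedes it below -/
import Mathlib

section
/- Let F_n and F be Herglotz functions with F_n → F uniformly on compact subsets of ℂ⁺. Then for every Borel set A ⊆ ℝ with |A| < ∞, the convergence ∫_A ω_{F_n(t)}(S) dt → ∫_A ω_{F(t)}(S) dt holds uniformly in the Borel set S ⊆ ℝ; that is, sup_{S Borel} |∫_A ω_{F_n(t)}(S) dt − ∫_A ω_{F(t)}(S) dt| → 0 as n → ∞. -/
open Filter Topology MeasureTheory Complex

/-- A Herglotz function: a holomorphic map of the upper half plane to itself. -/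
def IsHerglotz (F : ℂ → ℂ) : Prop :=
  DifferentiableOn ℂ F {z : ℂ | 0 < z.im} ∧ ∀ z : ℂ, 0 < z.im → 0 < (F z).im

/-- Harmonic measure of a Borel set S ⊆ ℝ seen from z ∈ ℂ⁺. -/
noncomputable def harmMeas (z : ℂ) (S : Set ℝ) : ℝ :=
  (1 / Real.pi) * ∫ t in S, z.im / ((t - z.re) ^ 2 + z.im ^ 2)

open ProbabilityTheory

/-- Cauchy's theorem on the half plane for functions decaying quadratically. -/
theorem integral_eq_zero_of_decay {Φ : ℂ → ℂ} {δ C R₀ : ℝ} (hδ : 0 < δ)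
    (hΦ : DifferentiableOn ℂ Φ {w | -δ < w.im}) (hInt : Integrable fun t : ℝ => Φ t)
    (hbound : ∀ w : ℂ, 0 ≤ w.im → R₀ ≤ ‖w‖ → ‖Φ w‖ ≤ C / ‖w‖ ^ 2) :
    ∫ t : ℝ, Φ t = 0 := by
  have h1 : Tendsto (fun R : ℝ => ∫ t in (-R)..R, Φ t) atTop (𝓝 (∫ t : ℝ, Φ t)) :=
    intervalIntegral_tendsto_integral hInt tendsto_neg_atTop_atBot tendsto_id
  refine tendsto_nhds_unique h1 ?_
  have h2 : Tendsto (fun R : ℝ => 4 * |C| * R⁻¹) atTop (𝓝 0) := by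
    simpa using tendsto_inv_atTop_zero.const_mul (4 * |C|)
  refine squeeze_zero_norm' ?_ h2
  filter_upwards [eventually_gt_atTop 0, eventually_ge_atTop R₀] with R hR hRR
  have key : ∀ w : ℂ, 0 ≤ w.im → R ≤ ‖w‖ → ‖Φ w‖ ≤ |C| / R ^ 2 := by
    intro w hw hRw
    refine (hbound w hw (hRR.trans hRw)).trans ?_
    gcongr
    exact le_abs_self C
  have hrect := integral_boundary_rect_eq_zero_of_differentiableOn Φ (-R : ℝ) (R + R * I)
    (hΦ.mono (by
      intro w hw
      have := hw.2
      simp only [Set.mem_preimage, ofReal_im, add_im, mul_im, I_re, I_im, ofReal_re] at this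
      norm_num at this
      rw [Set.uIcc_of_le hR.le] at this
      simp only [Set.mem_ofPred_eq]
      linarith [this.1]))
  simp only [ofReal_re, ofReal_im, add_re, add_im, mul_re, mul_im, I_re, I_im, mul_zero, mul_one,
    sub_zero, add_zero, zero_add, ofReal_zero, zero_mul] at hrect
  have htop : ‖∫ x : ℝ in (-R)..R, Φ (x + R * I)‖ ≤ |C| / R ^ 2 * |R - (-R)| := by
    refine intervalIntegral.norm_integral_le_of_norm_le_const fun x _ => key _ (by simp [hR.le]) ?_
    simpa [abs_of_pos hR] using Complex.abs_im_le_norm (x + R * I)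
  have hside : ∀ a : ℝ, |a| = R →
      ‖∫ y : ℝ in (0:ℝ)..R, Φ (a + y * I)‖ ≤ |C| / R ^ 2 * |R - 0| := by
    intro a ha
    refine intervalIntegral.norm_integral_le_of_norm_le_const fun y hy => key _ ?_ ?_
    · rw [Set.uIoc_of_le hR.le] at hy
      simpa using hy.1.le
    · simpa [ha] using Complex.abs_re_le_norm (a + y * I)
  have hr := hside R (abs_of_pos hR)
  have hl := hside (-R) (by simp [abs_of_pos hR])
  have heq : (∫ t in (-R)..R, Φ t) = (∫ x : ℝ in (-R)..R, Φ (x + R * I))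
      - I • (∫ y : ℝ in (0:ℝ)..R, Φ (R + y * I))
      + I • (∫ y : ℝ in (0:ℝ)..R, Φ ((-R : ℝ) + y * I)) := by
    linear_combination hrect
  rw [heq]
  refine (norm_add_le _ _).trans ((add_le_add_left (norm_sub_le _ _) _).trans ?_)
  rw [norm_smul, norm_smul, norm_I, one_mul, one_mul]
  refine (add_le_add (add_le_add htop hr) hl).trans_eq ?_
  rw [sub_neg_eq_add, sub_zero, abs_of_pos hR, abs_of_pos (add_pos hR hR)]
  field_simp
  ring

theorem integral_cauchyMeasure {E : Type*} [NormedAddCommGroup E] [NormedSpace ℝ E] (f : ℝ → E) :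
    ∫ x, f x ∂(cauchyMeasure 0 1) = ∫ x : ℝ, (Real.pi⁻¹ * (1 + x ^ 2)⁻¹) • f x := by
  rw [cauchyMeasure, if_neg one_ne_zero, integral_withDensity_eq_integral_toReal_smul (by fun_prop)
    (by simp [cauchyPDF])]
  refine integral_congr_ae (.of_forall fun x => ?_)
  simp only [cauchyPDF, cauchyPDFReal]
  rw [ENNReal.toReal_ofReal (by positivity)]
  simp [add_comm]

/-- Poisson's formula at `I` for bounded holomorphic functions on the half plane. -/
theorem integral_cauchyMeasure_eq_apply_I {H : ℂ → ℂ} {δ M : ℝ} (hδ : 0 < δ) (hδ1 : δ ≤ 1)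
    (hH : DifferentiableOn ℂ H {w | -δ < w.im}) (hM : ∀ w : ℂ, -δ < w.im → ‖H w‖ ≤ M) :
    ∫ x : ℝ, H x ∂(cauchyMeasure 0 1) = H I := by
  have hopen : IsOpen {w : ℂ | -δ < w.im} := isOpen_lt continuous_const continuous_im
  have hI : (I : ℂ) ∈ {w : ℂ | -δ < w.im} := by
    simp only [Set.mem_ofPred_eq, I_im]
    linarith
  have hcont : Continuous fun t : ℝ => H t :=
    hH.continuousOn.comp_continuous continuous_ofReal fun t => by simpa using hδ
  have hbd : ∀ t : ℝ, ‖H t‖ ≤ M := fun t => hM t (by simpa using hδ)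
  have hHint : Integrable (fun t : ℝ => H t) (cauchyMeasure 0 1) :=
    .of_bound hcont.aestronglyMeasurable M (.of_forall hbd)
  have hreal : ∀ t : ℝ, dslope H I t / (t + I) = (1 + t ^ 2 : ℝ)⁻¹ • (H t - H I) := by
    intro t
    have h1 : (t : ℂ) - I ≠ 0 := fun h => by simpa using congrArg im h
    have h2 : (t : ℂ) + I ≠ 0 := fun h => by simpa using congrArg im h
    have h3 : ((t : ℂ) - I) * (t + I) = 1 + t ^ 2 := by
      ring_nf
      simp [add_comm]
    rw [dslope_of_ne _ (sub_ne_zero.1 h1), slope_def_field, div_div, h3, real_smul]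
    push_cast
    field_simp
  have key : ∫ t : ℝ, dslope H I t / (t + I) = 0 := by
    refine integral_eq_zero_of_decay (Φ := fun w => dslope H I w / (w + I)) (δ := δ)
      (C := 8 * M) (R₀ := 2) hδ ?_ ?_ ?_
    · refine ((differentiableOn_dslope (hopen.mem_nhds hI)).2 hH).div (by fun_prop) ?_
      intro w hw h
      have := congrArg im h
      simp only [add_im, I_im, zero_im] at this
      simp only [Set.mem_ofPred_eq] at hw
      linarith
    · simp only [hreal]
      refine Integrable.smul_bdd integrable_inv_one_add_sq (M + M)
        (hcont.sub continuous_const).aestronglyMeasurable (.of_forall fun t => ?_)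
      exact (norm_sub_le _ _).trans (add_le_add (hbd t) (hM I hI))
    · intro w hw hw2
      have hwI : w ≠ I := by
        rintro rfl
        norm_num at hw2
      have h1 : ‖w‖ / 2 ≤ ‖w - I‖ := by
        have := norm_sub_norm_le w I
        rw [norm_I] at this
        linarith
      have h2 : ‖w‖ / 2 ≤ ‖w + I‖ := by
        have := norm_sub_le_norm_add w I
        rw [norm_I] at this
        linarith
      have h3 : ‖H w - H I‖ ≤ M + M :=
        (norm_sub_le _ _).trans (add_le_add (hM w (by linarith)) (hM I hI))
      have hM0 : 0 ≤ M := (norm_nonneg _).trans (hM I hI)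
      rw [dslope_of_ne _ hwI, slope_def_field, div_div, norm_div, norm_mul]
      calc ‖H w - H I‖ / (‖w - I‖ * ‖w + I‖) ≤ (M + M) / (‖w‖ / 2 * (‖w‖ / 2)) := by
            gcongr
        _ = 8 * M / ‖w‖ ^ 2 := by
            field_simp
            ring
  have : ∫ x : ℝ, (H x - H I) ∂(cauchyMeasure 0 1) = 0 := by
    rw [integral_cauchyMeasure]
    simp_rw [hreal] at key
    simp_rw [mul_smul]
    rw [integral_smul, key, smul_zero]
  rw [integral_sub hHint (integrable_const _)] at this
  simpa [sub_eq_zero] using this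

/-- Poisson's formula for bounded holomorphic functions on the half plane. -/
theorem integral_cauchyMeasure_eq_apply {H : ℂ → ℂ} {δ M : ℝ} (hδ : 0 < δ)
    (hH : DifferentiableOn ℂ H {w | -δ < w.im}) (hM : ∀ w : ℂ, -δ < w.im → ‖H w‖ ≤ M)
    {z : ℂ} (hz : 0 < z.im) :
    ∫ x : ℝ, H ((z.re + x * z.im : ℝ)) ∂(cauchyMeasure 0 1) = H z := by
  have hmaps : ∀ w : ℂ, -min (δ / z.im) 1 < w.im → -δ < (z.re + w * z.im).im := by
    intro w hw
    have h1 : -(δ / z.im) < w.im := (neg_le_neg (min_le_left _ _)).trans_lt hw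
    rw [← neg_div, div_lt_iff₀ hz] at h1
    simpa using h1
  have := integral_cauchyMeasure_eq_apply_I (H := fun w => H (z.re + w * z.im))
    (δ := min (δ / z.im) 1) (M := M) (by positivity) (min_le_right _ _)
    (hH.comp (by fun_prop) hmaps) (fun w hw => hM _ (hmaps w hw))
  push_cast
  rw [this, mul_comm I, re_add_im]

theorem poissonKernel_eq_cauchyPDFReal {w : ℂ} (hw : 0 < w.im) (t : ℝ) :
    w.im / ((t - w.re) ^ 2 + w.im ^ 2) =
      Real.pi * cauchyPDFReal w.re (Real.toNNReal w.im) t := by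
  rw [cauchyPDFReal, Real.coe_toNNReal _ hw.le]
  field_simp

theorem integrable_poissonKernel {w : ℂ} (hw : 0 < w.im) :
    Integrable fun t : ℝ => w.im / ((t - w.re) ^ 2 + w.im ^ 2) := by
  simp_rw [poissonKernel_eq_cauchyPDFReal hw]
  exact (integrable_cauchyPDFReal w.re).const_mul Real.pi

theorem integral_poissonKernel {w : ℂ} (hw : 0 < w.im) :
    ∫ t : ℝ, w.im / ((t - w.re) ^ 2 + w.im ^ 2) = Real.pi := by
  simp_rw [poissonKernel_eq_cauchyPDFReal hw]
  rw [integral_const_mul, integral_cauchyPDFReal_eq_one w.re (Real.toNNReal_pos.2 hw).ne', mul_one]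

theorem poissonKernel_nonneg {w : ℂ} (hw : 0 < w.im) (t : ℝ) :
    0 ≤ w.im / ((t - w.re) ^ 2 + w.im ^ 2) := by
  positivity

theorem poissonKernel_eq_im_inv (w : ℂ) (t : ℝ) :
    w.im / ((t - w.re) ^ 2 + w.im ^ 2) = ((t - w : ℂ)⁻¹).im := by
  simp [normSq_apply, pow_two]

theorem harmMeas_nonneg {w : ℂ} (hw : 0 < w.im) (S : Set ℝ) : 0 ≤ harmMeas w S :=
  mul_nonneg (by positivity) (integral_nonneg (poissonKernel_nonneg hw))

theorem harmMeas_le_one {w : ℂ} (hw : 0 < w.im) (S : Set ℝ) : harmMeas w S ≤ 1 := by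
  have h := setIntegral_le_integral (s := S) (integrable_poissonKernel hw)
    (.of_forall (poissonKernel_nonneg hw))
  rw [integral_poissonKernel hw] at h
  calc harmMeas w S ≤ 1 / Real.pi * Real.pi := mul_le_mul_of_nonneg_left h (by positivity)
    _ = 1 := by field_simp

theorem norm_harmMeas_le_one {w : ℂ} (hw : 0 < w.im) (S : Set ℝ) : ‖harmMeas w S‖ ≤ 1 := by
  rw [Real.norm_of_nonneg (harmMeas_nonneg hw S)]
  exact harmMeas_le_one hw S

theorem abs_poissonKernel_sub_le {w v : ℂ} (hw : 0 < w.im) (hv : 0 < v.im) (t : ℝ) :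
    |w.im / ((t - w.re) ^ 2 + w.im ^ 2) - v.im / ((t - v.re) ^ 2 + v.im ^ 2)| ≤
      ‖w - v‖ / 2 * (w.im⁻¹ * (w.im / ((t - w.re) ^ 2 + w.im ^ 2)) +
        v.im⁻¹ * (v.im / ((t - v.re) ^ 2 + v.im ^ 2))) := by
  have hne : ∀ {u : ℂ}, 0 < u.im → (t - u : ℂ) ≠ 0 := fun hu h => by
    have := congrArg im h
    simp only [sub_im, ofReal_im, zero_im] at this
    linarith
  have hsq : ∀ {u : ℂ}, 0 < u.im →
      u.im⁻¹ * (u.im / ((t - u.re) ^ 2 + u.im ^ 2)) = ‖(t - u : ℂ)⁻¹‖ ^ 2 := by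
    intro u hu
    rw [norm_inv, inv_pow, Complex.sq_norm, normSq_apply, ← mul_div_assoc,
      inv_mul_cancel₀ hu.ne', one_div]
    simp only [sub_re, ofReal_re, sub_im, ofReal_im]
    ring
  rw [hsq hw, hsq hv, poissonKernel_eq_im_inv, poissonKernel_eq_im_inv, ← sub_im,
    inv_sub_inv (hne hw) (hne hv)]
  refine (abs_im_le_norm _).trans ?_
  have : (t - v - (t - w) : ℂ) = w - v := by ring
  rw [this, norm_div, norm_mul, norm_inv, norm_inv, div_eq_mul_inv, mul_inv]
  have := mul_le_mul_of_nonneg_left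
    (two_mul_le_add_sq (‖(t - w : ℂ)‖⁻¹) (‖(t - v : ℂ)‖⁻¹)) (norm_nonneg (w - v))
  linarith

/-- Harmonic measure is locally Lipschitz in the base point, uniformly in the set. -/
theorem abs_harmMeas_sub_le {w v : ℂ} (hw : 0 < w.im) (hv : 0 < v.im) (S : Set ℝ) :
    |harmMeas w S - harmMeas v S| ≤ ‖w - v‖ / 2 * (w.im⁻¹ + v.im⁻¹) := by
  have iw := integrable_poissonKernel hw
  have iv := integrable_poissonKernel hv
  unfold harmMeas
  rw [← mul_sub, ← integral_sub iw.integrableOn iv.integrableOn, abs_mul,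
    abs_of_pos (by positivity : 0 < 1 / Real.pi)]
  have ig := ((iw.const_mul w.im⁻¹).add (iv.const_mul v.im⁻¹)).const_mul (‖w - v‖ / 2)
  have h : |∫ t in S, (w.im / ((t - w.re) ^ 2 + w.im ^ 2) - v.im / ((t - v.re) ^ 2 + v.im ^ 2))|
      ≤ ‖w - v‖ / 2 * (w.im⁻¹ * Real.pi + v.im⁻¹ * Real.pi) := by
    calc _ ≤ ∫ t in S, |w.im / ((t - w.re) ^ 2 + w.im ^ 2) - v.im / ((t - v.re) ^ 2 + v.im ^ 2)| :=
          abs_integral_le_integral_abs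
      _ ≤ ∫ t, |w.im / ((t - w.re) ^ 2 + w.im ^ 2) - v.im / ((t - v.re) ^ 2 + v.im ^ 2)| :=
          setIntegral_le_integral (iw.sub iv).abs (.of_forall fun t => abs_nonneg _)
      _ ≤ _ := integral_mono (iw.sub iv).abs ig (abs_poissonKernel_sub_le hw hv)
      _ = _ := by
          simp only [Pi.add_apply]
          rw [integral_const_mul, integral_add (iw.const_mul _) (iv.const_mul _),
            integral_const_mul, integral_const_mul, integral_poissonKernel hw,
            integral_poissonKernel hv]
  calc _ ≤ 1 / Real.pi * (‖w - v‖ / 2 * (w.im⁻¹ * Real.pi + v.im⁻¹ * Real.pi)) := by gcongr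
    _ = _ := by field_simp

theorem continuousOn_harmMeas (S : Set ℝ) :
    ContinuousOn (fun w => harmMeas w S) {w : ℂ | 0 < w.im} := by
  intro w hw
  refine ContinuousAt.continuousWithinAt ?_
  rw [ContinuousAt, tendsto_iff_dist_tendsto_zero]
  have hlim : Tendsto (fun v : ℂ => ‖v - w‖ / 2 * (v.im⁻¹ + w.im⁻¹)) (𝓝 w) (𝓝 0) := by
    have : ContinuousAt (fun v : ℂ => ‖v - w‖ / 2 * (v.im⁻¹ + w.im⁻¹)) w := by
      have hw' : w.im ≠ 0 := ne_of_gt hw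
      have := (continuous_im.continuousAt (x := w)).inv₀ hw'
      fun_prop
    simpa [ContinuousAt] using this
  refine squeeze_zero' (.of_forall fun _ => dist_nonneg) ?_ hlim
  filter_upwards [(isOpen_lt continuous_const continuous_im).mem_nhds hw] with v hv
  exact abs_harmMeas_sub_le hv hw S
theorem integrable_of_continuous_of_norm_le_one {X : Type*} [TopologicalSpace X] [MeasurableSpace X]
    [OpensMeasurableSpace X] [SecondCountableTopology X]
    {μ : Measure X} [IsFiniteMeasure μ] {u : X → ℝ} (hu : Continuous u) (h1 : ∀ x, ‖u x‖ ≤ 1) :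
    Integrable u μ :=
  .of_bound hu.aestronglyMeasurable 1 (.of_forall h1)

/-- Poisson's formula for the harmonic measure of a set along a holomorphic map whose imaginary
part is bounded below. -/
theorem integral_harmMeas_of_le_im {G : ℂ → ℂ} {δ η : ℝ} (hδ : 0 < δ) (hη : 0 < η)
    (hG : DifferentiableOn ℂ G {w | -δ < w.im}) (hGη : ∀ w : ℂ, -δ < w.im → η ≤ (G w).im)
    {z : ℂ} (hz : 0 < z.im) (S : Set ℝ) :
    ∫ x : ℝ, harmMeas (G ((z.re + x * z.im : ℝ))) S ∂(cauchyMeasure 0 1) = harmMeas (G z) S := by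
  have hmem : ∀ x : ℝ, -δ < ((x : ℝ) : ℂ).im := fun x => by simpa using hδ
  have him : ∀ w : ℂ, -δ < w.im → 0 < (G w).im := fun w hw => hη.trans_le (hGη w hw)
  have hGc : Continuous fun x : ℝ => G ((z.re + x * z.im : ℝ)) :=
    hG.continuousOn.comp_continuous (by fun_prop) fun x => hmem _
  have hpoint : ∀ s : ℝ,
      ∫ x : ℝ, (G ((z.re + x * z.im : ℝ))).im /
        ((s - (G ((z.re + x * z.im : ℝ))).re) ^ 2 + (G ((z.re + x * z.im : ℝ))).im ^ 2)
          ∂(cauchyMeasure 0 1) =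
      (G z).im / ((s - (G z).re) ^ 2 + (G z).im ^ 2) := by
    intro s
    have hlow : ∀ w : ℂ, -δ < w.im → η ≤ ‖(s : ℂ) - G w‖ := by
      intro w hw
      have := abs_im_le_norm ((s : ℂ) - G w)
      simp only [sub_im, ofReal_im, zero_sub, abs_neg] at this
      exact (hGη w hw).trans ((le_abs_self _).trans this)
    have hne : ∀ w : ℂ, -δ < w.im → (s : ℂ) - G w ≠ 0 := fun w hw =>
      norm_pos_iff.1 (hη.trans_le (hlow w hw))
    have hH : DifferentiableOn ℂ (fun w => ((s : ℂ) - G w)⁻¹) {w | -δ < w.im} :=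
      (hG.const_sub _).inv hne
    have hb : ∀ w : ℂ, -δ < w.im → ‖((s : ℂ) - G w)⁻¹‖ ≤ η⁻¹ := by
      intro w hw
      rw [norm_inv]
      gcongr
      exact hlow w hw
    simp_rw [poissonKernel_eq_im_inv]
    rw [← integral_cauchyMeasure_eq_apply hδ hH hb hz]
    refine integral_im (𝕜 := ℂ) (.of_bound ?_ η⁻¹ (.of_forall fun x => hb _ (hmem _)))
    exact (hH.continuousOn.comp_continuous (by fun_prop) fun x => hmem _).aestronglyMeasurable
  unfold harmMeas
  rw [integral_const_mul]
  congr 1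
  rw [integral_integral_swap]
  · simp_rw [hpoint]
  · have hK : Continuous fun p : ℝ × ℝ => (G ((z.re + p.1 * z.im : ℝ))).im /
        ((p.2 - (G ((z.re + p.1 * z.im : ℝ))).re) ^ 2 + (G ((z.re + p.1 * z.im : ℝ))).im ^ 2) := by
      have h1 : Continuous fun p : ℝ × ℝ => G ((z.re + p.1 * z.im : ℝ)) := hGc.comp continuous_fst
      have h2 := continuous_im.comp h1
      have h3 := continuous_re.comp h1
      refine h2.div (((continuous_snd.sub h3).pow 2).add (h2.pow 2)) fun p => ?_
      have := him _ (hmem (z.re + p.1 * z.im))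
      positivity
    refine (integrable_prod_iff hK.aestronglyMeasurable).2 ⟨.of_forall fun x =>
      (integrable_poissonKernel (him _ (hmem (z.re + x * z.im)))).restrict, ?_⟩
    have hh : Continuous fun x : ℝ => harmMeas (G ((z.re + x * z.im : ℝ))) S :=
      (continuousOn_harmMeas S).comp_continuous hGc fun x => him _ (hmem _)
    refine (((integrable_of_continuous_of_norm_le_one hh fun x =>
      norm_harmMeas_le_one (him _ (hmem _)) S).const_mul Real.pi)).congr (.of_forall fun x => ?_)
    simp only
    simp_rw [Real.norm_of_nonneg (poissonKernel_nonneg (him _ (hmem (z.re + x * z.im))) _)]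
    unfold harmMeas
    field_simp

namespace IsHerglotz

variable {F : ℂ → ℂ}

theorem continuous_harmMeas_comp (hF : IsHerglotz F) {y : ℝ} (hy : 0 < y) (S : Set ℝ) :
    Continuous fun t : ℝ => harmMeas (F (t + y * I)) S :=
  (continuousOn_harmMeas S).comp_continuous
    (hF.1.continuousOn.comp_continuous (by fun_prop) fun t => by simpa using hy)
    fun t => hF.2 _ (by simpa using hy)

theorem norm_harmMeas_comp_le_one (hF : IsHerglotz F) {y : ℝ} (hy : 0 < y) (S : Set ℝ) (t : ℝ) :
    ‖harmMeas (F (t + y * I)) S‖ ≤ 1 :=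
  norm_harmMeas_le_one (hF.2 _ (by simpa using hy)) S

/-- Poisson's formula for the harmonic measure of a set along a Herglotz function, between two
horizontal lines. -/
theorem integral_harmMeas_comp (hF : IsHerglotz F) {y δ : ℝ} (hy : 0 < y) (hδ : 0 < δ) (t : ℝ)
    (S : Set ℝ) :
    ∫ x : ℝ, harmMeas (F ((t + x * y : ℝ) + δ * I)) S ∂(cauchyMeasure 0 1) =
      harmMeas (F (t + (y + δ : ℝ) * I)) S := by
  have himF : ∀ w : ℂ, -δ < w.im → 0 < (F (w + δ * I)).im := fun w hw =>
    hF.2 _ (by simpa using by linarith)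
  have key : ∀ η : ℝ, 0 < η →
      ∫ x : ℝ, harmMeas (F ((t + x * y : ℝ) + δ * I) + η * I) S ∂(cauchyMeasure 0 1) =
        harmMeas (F (t + (y + δ : ℝ) * I) + η * I) S := by
    intro η hη
    have h := integral_harmMeas_of_le_im (G := fun w => F (w + δ * I) + η * I) hδ hη
      ((hF.1.comp (by fun_prop) fun w hw => by
        simp only [Set.mem_ofPred_eq] at hw
        simpa using by linarith).add_const _)
      (fun w hw => by simpa using (himF w hw).le) (z := t + y * I) (by simpa using hy) S
    simp only [add_re, ofReal_re, mul_re, I_re, mul_zero, ofReal_im, I_im, mul_one, sub_self,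
      add_zero, add_im, mul_im, zero_add] at h
    rw [h]
    congr 3
    push_cast
    ring
  have hlim : ∀ w : ℂ, 0 < w.im →
      Tendsto (fun η : ℝ => harmMeas (w + η * I) S) (𝓝[>] 0) (𝓝 (harmMeas w S)) := by
    intro w hw
    have h1 : ContinuousAt (fun v => harmMeas v S) w :=
      (continuousOn_harmMeas S).continuousAt
        ((isOpen_lt continuous_const continuous_im).mem_nhds hw)
    have h2 : Tendsto (fun η : ℝ => w + η * I) (𝓝[>] 0) (𝓝 w) := by
      have : Continuous fun η : ℝ => w + η * I := by fun_prop
      simpa using (this.tendsto 0).mono_left nhdsWithin_le_nhds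
    exact h1.tendsto.comp h2
  have hmem : ∀ x : ℝ, -δ < ((x : ℝ) : ℂ).im := fun x => by simpa using hδ
  have hR := hlim (F (t + (y + δ : ℝ) * I)) (hF.2 _ (by simpa using by positivity))
  refine tendsto_nhds_unique (tendsto_integral_filter_of_dominated_convergence (fun _ => (1 : ℝ))
    ?_ ?_ (integrable_const 1)
    (.of_forall fun x : ℝ => hlim (F ((t + x * y : ℝ) + δ * I)) (himF _ (hmem _)))) (hR.congr' ?_)
  · filter_upwards [self_mem_nhdsWithin] with η hη
    refine Continuous.aestronglyMeasurable ?_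
    refine (continuousOn_harmMeas S).comp_continuous (.add ?_ continuous_const) fun x => ?_
    · exact hF.1.continuousOn.comp_continuous (by fun_prop) fun x => by simpa using hδ
    · have h1 := himF _ (hmem (t + x * y))
      have h2 : 0 < η := hη
      simpa using add_pos h1 h2
  · filter_upwards [self_mem_nhdsWithin] with η hη
    refine .of_forall fun x => norm_harmMeas_le_one ?_ S
    have h1 := himF _ (hmem (t + x * y))
    have h2 : 0 < η := hη
    simpa using add_pos h1 h2
  · filter_upwards [self_mem_nhdsWithin] with η hη
    exact (key η hη).symm

end IsHerglotz

/-- The measure of the symmetric difference of a set and its translate. -/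
noncomputable def translateDefect (A : Set ℝ) (h : ℝ) : ℝ :=
  volume.real (symmDiff ((fun t => t - h) ⁻¹' A) A)

theorem measurable_translateDefect {A : Set ℝ} (hA : MeasurableSet A) :
    Measurable (translateDefect A) := by
  have h1 : Measurable fun p : ℝ × ℝ => p.2 - p.1 := by fun_prop
  exact (measurable_measure_prodMk_left
    (((h1 hA).symmDiff (measurable_snd hA)))).ennreal_toReal

theorem volume_preimage_sub_const (A : Set ℝ) (h : ℝ) :
    volume ((fun t => t - h) ⁻¹' A) = volume A :=
  (measurePreserving_sub_right volume h).measure_preimage_equiv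
    (f := MeasurableEquiv.subRight h) A

theorem translateDefect_le {A : Set ℝ} (hAfin : volume A < ⊤) (h : ℝ) :
    translateDefect A h ≤ 2 * volume.real A := by
  have h1 : volume ((fun t => t - h) ⁻¹' A ∪ A) ≤ volume A + volume A :=
    (measure_union_le _ _).trans_eq (by rw [volume_preimage_sub_const])
  have h2 := ENNReal.toReal_mono (ENNReal.add_ne_top.2 ⟨hAfin.ne, hAfin.ne⟩)
    ((measure_mono (μ := volume)
      (symmDiff_le_sup (a := (fun t => t - h) ⁻¹' A) (b := A))).trans h1)
  rw [ENNReal.toReal_add hAfin.ne hAfin.ne, ← two_mul] at h2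
  exact h2

theorem tendsto_translateDefect {A : Set ℝ} (hA : MeasurableSet A) (hAfin : volume A < ⊤) :
    Tendsto (translateDefect A) (𝓝 0) (𝓝 0) := by
  let f : C(ℝ, C(ℝ, ℝ)) := ContinuousMap.curry ⟨fun p : ℝ × ℝ => p.2 - p.1, by fun_prop⟩
  have h := tendsto_measure_symmDiff_preimage_nhds_zero (μ := volume) (ν := volume)
    (f.continuous.tendsto 0) (.of_forall fun h => measurePreserving_sub_right volume h)
    (measurePreserving_sub_right volume 0) hA.nullMeasurableSet hAfin.ne
  have h0 : (f 0 : ℝ → ℝ) ⁻¹' A = A := by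
    ext t
    simp [f]
  rw [h0] at h
  exact (ENNReal.tendsto_toReal ENNReal.zero_ne_top).comp h

/-- Cauchy average of the symmetric differences of a set and its translates. -/
noncomputable def cauchyDefect (A : Set ℝ) (y : ℝ) : ℝ :=
  ∫ x, translateDefect A (x * y) ∂(cauchyMeasure 0 1)

theorem norm_translateDefect_le {A : Set ℝ} (hAfin : volume A < ⊤) (h : ℝ) :
    ‖translateDefect A h‖ ≤ 2 * volume.real A := by
  rw [translateDefect, Real.norm_of_nonneg measureReal_nonneg]
  exact translateDefect_le hAfin h

theorem integrable_translateDefect {A : Set ℝ} (hA : MeasurableSet A) (hAfin : volume A < ⊤)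
    (y : ℝ) : Integrable (fun x => translateDefect A (x * y)) (cauchyMeasure 0 1) :=
  .of_bound ((measurable_translateDefect hA).comp (measurable_mul_const y)).aestronglyMeasurable
    _ (.of_forall fun _ => norm_translateDefect_le hAfin _)

theorem tendsto_cauchyDefect {A : Set ℝ} (hA : MeasurableSet A) (hAfin : volume A < ⊤) :
    Tendsto (cauchyDefect A) (𝓝 0) (𝓝 0) := by
  have h := tendsto_integral_filter_of_dominated_convergence (μ := cauchyMeasure 0 1) (l := 𝓝 0)
    (F := fun y x => translateDefect A (x * y)) (f := fun _ => 0) (fun _ => 2 * volume.real A)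
    (.of_forall fun y => (integrable_translateDefect hA hAfin y).aestronglyMeasurable)
    (.of_forall fun y => .of_forall fun _ => norm_translateDefect_le hAfin _)
    (integrable_const _) (.of_forall fun x => (tendsto_translateDefect hA hAfin).comp (by
      have : Continuous fun y : ℝ => x * y := by fun_prop
      simpa using this.tendsto 0))
  rw [integral_zero] at h
  exact h

theorem abs_setIntegral_sub_le {X : Type*} [MeasurableSpace X] {μ : Measure X} {A B : Set X}
    (hA : MeasurableSet A) (hB : MeasurableSet B) (hAfin : μ A ≠ ⊤) (hBfin : μ B ≠ ⊤) {u : X → ℝ}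
    (hu : AEStronglyMeasurable u μ) (h1 : ∀ x, ‖u x‖ ≤ 1) :
    |(∫ x in A, u x ∂μ) - ∫ x in B, u x ∂μ| ≤ μ.real (symmDiff A B) := by
  have iA : IntegrableOn u A μ := .of_bound hAfin.lt_top hu.restrict 1 (.of_forall h1)
  have iB : IntegrableOn u B μ := .of_bound hBfin.lt_top hu.restrict 1 (.of_forall h1)
  have hs := hA.symmDiff hB
  have hsfin : μ (symmDiff A B) ≠ ⊤ :=
    ne_top_of_le_ne_top (measure_union_ne_top hAfin hBfin) (measure_mono symmDiff_le_sup)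
  rw [← integral_indicator hA, ← integral_indicator hB,
    ← integral_sub (iA.integrable_indicator hA) (iB.integrable_indicator hB),
    ← integral_indicator_one hs, ← Real.norm_eq_abs]
  refine norm_integral_le_of_norm_le
    ((integrableOn_const (C := (1 : ℝ)) hsfin).integrable_indicator hs) (.of_forall fun x => ?_)
  by_cases hxA : x ∈ A <;> by_cases hxB : x ∈ B <;>
    simp [Set.indicator, Set.mem_symmDiff, hxA, hxB] <;> simpa using h1 x

theorem abs_setIntegral_sub_translate_le {A : Set ℝ} (hA : MeasurableSet A)
    (hAfin : volume A < ⊤) {u : ℝ → ℝ} (hu : Continuous u) (h1 : ∀ t, ‖u t‖ ≤ 1) (h : ℝ) :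
    |(∫ t in A, u (t + h)) - ∫ t in A, u t| ≤ translateDefect A h := by
  have hpre : (fun t => t + h) ⁻¹' ((fun t => t - h) ⁻¹' A) = A := by
    ext t
    simp
  have := (measurePreserving_add_right volume h).setIntegral_preimage_emb
    (MeasurableEquiv.addRight h).measurableEmbedding u ((fun t => t - h) ⁻¹' A)
  rw [hpre] at this
  rw [this]
  exact abs_setIntegral_sub_le (measurable_sub_const h hA) hA
    (by rw [volume_preimage_sub_const]; exact hAfin.ne) hAfin.ne hu.aestronglyMeasurable h1

namespace IsHerglotz

variable {F : ℂ → ℂ}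

theorem abs_setIntegral_harmMeas_sub_le (hF : IsHerglotz F) {A : Set ℝ} (hA : MeasurableSet A)
    (hAfin : volume A < ⊤) (S : Set ℝ) {y δ : ℝ} (hy : 0 < y) (hδ : 0 < δ) :
    |(∫ t in A, harmMeas (F (t + (y + δ : ℝ) * I)) S) - ∫ t in A, harmMeas (F (t + δ * I)) S| ≤
      cauchyDefect A y := by
  have : IsFiniteMeasure (volume.restrict A) := ⟨by simpa using hAfin⟩
  let u : ℝ → ℝ := fun t => harmMeas (F (t + δ * I)) S
  have hu : Continuous u := hF.continuous_harmMeas_comp hδ S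
  have h1 : ∀ t, ‖u t‖ ≤ 1 := hF.norm_harmMeas_comp_le_one hδ S
  have hInt : Integrable (Function.uncurry fun t x : ℝ => u (t + x * y))
      ((volume.restrict A).prod (cauchyMeasure 0 1)) :=
    integrable_of_continuous_of_norm_le_one (hu.comp (by fun_prop)) fun _ => h1 _
  have hInt' : Integrable (fun x : ℝ => ∫ t in A, u (t + x * y)) (cauchyMeasure 0 1) :=
    hInt.integral_prod_right
  have hswap : ∫ t in A, harmMeas (F (t + (y + δ : ℝ) * I)) S =
      ∫ x : ℝ, (∫ t in A, u (t + x * y)) ∂(cauchyMeasure 0 1) := by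
    rw [← integral_integral_swap hInt]
    exact integral_congr_ae (.of_forall fun t => (hF.integral_harmMeas_comp hy hδ t S).symm)
  have hconst : ∫ t in A, u t = ∫ _ : ℝ, (∫ t in A, u t) ∂(cauchyMeasure 0 1) := by simp
  change |_ - ∫ t in A, u t| ≤ _
  rw [hswap, hconst, ← integral_sub hInt' (integrable_const _), ← Real.norm_eq_abs]
  exact norm_integral_le_of_norm_le (integrable_translateDefect hA hAfin y)
    (.of_forall fun x => abs_setIntegral_sub_translate_le hA hAfin hu h1 _)

theorem abs_setIntegral_boundary_sub_le (hF : IsHerglotz F) {A : Set ℝ} (hA : MeasurableSet A)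
    (hAfin : volume A < ⊤) (S : Set ℝ) {g : ℝ → ℝ}
    (hg : ∀ᵐ t : ℝ, Tendsto (fun y : ℝ => harmMeas (F (t + y * I)) S) (𝓝[>] 0) (𝓝 (g t)))
    {y : ℝ} (hy : 0 < y) :
    |(∫ t in A, harmMeas (F (t + y * I)) S) - ∫ t in A, g t| ≤ cauchyDefect A y := by
  have : IsFiniteMeasure (volume.restrict A) := ⟨by simpa using hAfin⟩
  have h1 : Tendsto (fun δ : ℝ => ∫ t in A, harmMeas (F (t + δ * I)) S) (𝓝[>] 0)
      (𝓝 (∫ t in A, g t)) := by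
    refine tendsto_integral_filter_of_dominated_convergence (fun _ => (1 : ℝ)) ?_ ?_
      (integrable_const 1) (ae_restrict_of_ae hg)
    · filter_upwards [self_mem_nhdsWithin] with δ hδ
      exact (hF.continuous_harmMeas_comp hδ S).aestronglyMeasurable
    · filter_upwards [self_mem_nhdsWithin] with δ hδ
      exact .of_forall (hF.norm_harmMeas_comp_le_one hδ S)
  have h2 : Tendsto (fun δ : ℝ => ∫ t in A, harmMeas (F (t + (y + δ : ℝ) * I)) S) (𝓝[>] 0)
      (𝓝 (∫ t in A, harmMeas (F (t + y * I)) S)) := by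
    refine tendsto_integral_filter_of_dominated_convergence (fun _ => (1 : ℝ)) ?_ ?_
      (integrable_const 1) (.of_forall fun t => ?_)
    · filter_upwards [self_mem_nhdsWithin] with δ hδ
      exact (hF.continuous_harmMeas_comp (add_pos hy hδ) S).aestronglyMeasurable
    · filter_upwards [self_mem_nhdsWithin] with δ hδ
      exact .of_forall (hF.norm_harmMeas_comp_le_one (add_pos hy hδ) S)
    · have hz : (t + y * I : ℂ) ∈ {z : ℂ | 0 < z.im} := by simpa using hy
      have hopen : IsOpen {z : ℂ | 0 < z.im} := isOpen_lt continuous_const continuous_im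
      have hc : ContinuousAt (fun z => harmMeas (F z) S) (t + y * I) :=
        ((continuousOn_harmMeas S).comp hF.1.continuousOn hF.2).continuousAt (hopen.mem_nhds hz)
      have hl : Tendsto (fun δ : ℝ => (t + (y + δ : ℝ) * I : ℂ)) (𝓝[>] 0) (𝓝 (t + y * I)) := by
        have : Continuous fun δ : ℝ => (t + (y + δ : ℝ) * I : ℂ) := by fun_prop
        simpa using (this.tendsto 0).mono_left nhdsWithin_le_nhds
      exact hc.tendsto.comp hl
  refine le_of_tendsto (h2.sub h1).abs ?_
  filter_upwards [self_mem_nhdsWithin] with δ hδ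
  exact hF.abs_setIntegral_harmMeas_sub_le hA hAfin S hy hδ

end IsHerglotz

/-- On a horizontal line, the harmonic measures of a set along a convergent sequence of Herglotz
functions converge in mean on sets of finite measure, uniformly in the set. -/
theorem exists_bound_setIntegral_harmMeas_sub {F : ℕ → ℂ → ℂ} {Flim : ℂ → ℂ}
    (hF : ∀ n, IsHerglotz (F n)) (hFlim : IsHerglotz Flim)
    (hconv : ∀ z : ℂ, 0 < z.im → Tendsto (fun n => F n z) atTop (𝓝 (Flim z)))
    {A : Set ℝ} (hAfin : volume A < ⊤) {y : ℝ} (hy : 0 < y) :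
    ∃ b : ℕ → ℝ, Tendsto b atTop (𝓝 0) ∧ ∀ n (S : Set ℝ),
      |(∫ t in A, harmMeas (F n (t + y * I)) S) - ∫ t in A, harmMeas (Flim (t + y * I)) S| ≤
        b n := by
  have : IsFiniteMeasure (volume.restrict A) := ⟨by simpa using hAfin⟩
  have him : ∀ t : ℝ, 0 < (t + y * I : ℂ).im := fun t => by simpa using hy
  let φ : ℕ → ℝ → ℝ := fun n t => min 2 (‖F n (t + y * I) - Flim (t + y * I)‖ / 2 *
    ((F n (t + y * I)).im⁻¹ + (Flim (t + y * I)).im⁻¹))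
  have hφ0 : ∀ n t, 0 ≤ φ n t := fun n t => by
    have h1 := (hF n).2 _ (him t)
    have h2 := hFlim.2 _ (him t)
    positivity
  have hφ2 : ∀ n t, ‖φ n t‖ ≤ 2 := fun n t => by
    rw [Real.norm_of_nonneg (hφ0 n t)]
    exact min_le_left _ _
  have hline : ∀ {G : ℂ → ℂ}, IsHerglotz G → Continuous fun t : ℝ => G (t + y * I) := fun hG =>
    hG.1.continuousOn.comp_continuous (by fun_prop) him
  have hφc : ∀ n, Continuous (φ n) := fun n => by
    have c1 := hline (hF n)
    have c2 := hline hFlim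
    have c3 := (continuous_im.comp c1).inv₀ fun t => ((hF n).2 _ (him t)).ne'
    have c4 := (continuous_im.comp c2).inv₀ fun t => (hFlim.2 _ (him t)).ne'
    exact continuous_const.min (((c1.sub c2).norm.div_const 2).mul (c3.add c4))
  have hφi : ∀ n, Integrable (φ n) (volume.restrict A) := fun n =>
    .of_bound (hφc n).aestronglyMeasurable 2 (.of_forall (hφ2 n))
  refine ⟨fun n => ∫ t in A, φ n t, ?_, fun n S => ?_⟩
  · have hlim : ∀ t : ℝ, Tendsto (fun n => φ n t) atTop (𝓝 0) := by
      intro t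
      have h1 := hconv _ (him t)
      have h2 := ((continuous_im.tendsto _).comp h1).inv₀ (hFlim.2 _ (him t)).ne'
      have h3 := ((h1.sub_const (Flim (t + y * I))).norm.div_const 2).mul
        (h2.add_const (Flim (t + y * I)).im⁻¹)
      simpa using (tendsto_const_nhds (x := (2 : ℝ))).min h3
    simpa using tendsto_integral_of_dominated_convergence (μ := volume.restrict A)
      (fun _ => (2 : ℝ)) (fun n => (hφc n).aestronglyMeasurable) (integrable_const 2)
      (fun n => .of_forall (hφ2 n)) (.of_forall hlim)
  · have i1 := integrable_of_continuous_of_norm_le_one (μ := volume.restrict A)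
      ((hF n).continuous_harmMeas_comp hy S) ((hF n).norm_harmMeas_comp_le_one hy S)
    have i2 := integrable_of_continuous_of_norm_le_one (μ := volume.restrict A)
      (hFlim.continuous_harmMeas_comp hy S) (hFlim.norm_harmMeas_comp_le_one hy S)
    rw [← integral_sub i1 i2, ← Real.norm_eq_abs]
    refine norm_integral_le_of_norm_le (hφi n) (.of_forall fun t => le_min ?_ ?_)
    · refine (norm_sub_le _ _).trans ?_
      have h1 := (hF n).norm_harmMeas_comp_le_one hy S t
      have h2 := hFlim.norm_harmMeas_comp_le_one hy S t
      linarith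
    · exact abs_harmMeas_sub_le ((hF n).2 _ (him t)) (hFlim.2 _ (him t)) S

/-- Uniformity in S of the convergence in value distribution: for every ε > 0 there is an N
such that for all n ≥ N, all Borel sets S, and all (a.e.) boundary value functions
g_n = ω_{F_n(·)}(S), g = ω_{F(·)}(S) on ℝ, the integrals over A differ by at most ε. -/
theorem stmt8 (F : ℕ → ℂ → ℂ) (Flim : ℂ → ℂ)
    (hF : ∀ n, IsHerglotz (F n)) (hFlim : IsHerglotz Flim)
    (hconv : ∀ K : Set ℂ, K ⊆ {z : ℂ | 0 < z.im} → IsCompact K →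
      TendstoUniformlyOn (fun n => F n) Flim atTop K)
    (A : Set ℝ) (hA : MeasurableSet A) (hAfin : MeasureTheory.volume A < ⊤) :
    ∀ ε : ℝ, 0 < ε → ∃ N : ℕ, ∀ n, N ≤ n → ∀ S : Set ℝ, MeasurableSet S →
      ∀ g glim : ℝ → ℝ,
        (∀ᵐ t : ℝ, Tendsto (fun y : ℝ => harmMeas (F n (t + y * Complex.I)) S)
          (𝓝[>] 0) (𝓝 (g t))) →
        (∀ᵐ t : ℝ, Tendsto (fun y : ℝ => harmMeas (Flim (t + y * Complex.I)) S)
          (𝓝[>] 0) (𝓝 (glim t))) →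
        |(∫ t in A, g t) - ∫ t in A, glim t| ≤ ε := by
  intro ε hε
  have hE : ∀ᶠ y in 𝓝[>] (0 : ℝ), cauchyDefect A y < ε / 4 :=
    ((tendsto_cauchyDefect hA hAfin).mono_left nhdsWithin_le_nhds).eventually_lt_const
      (by positivity)
  obtain ⟨y, hyE, hy⟩ := (hE.and self_mem_nhdsWithin).exists
  obtain ⟨b, hb, hbound⟩ := exists_bound_setIntegral_harmMeas_sub hF hFlim
    (fun z hz => (hconv {z} (by simpa using hz) isCompact_singleton).tendsto_at rfl) hAfin hy
  obtain ⟨N, hN⟩ := eventually_atTop.1 (hb.eventually_lt_const (half_pos hε))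
  refine ⟨N, fun n hn S _ g glim hg hglim => ?_⟩
  have h1 := abs_le.1 ((hF n).abs_setIntegral_boundary_sub_le hA hAfin S hg hy)
  have h2 := abs_le.1 (hFlim.abs_setIntegral_boundary_sub_le hA hAfin S hglim hy)
  have h3 := abs_le.1 (hbound n S)
  have h4 := hN n hn
  rw [abs_le]
  constructor <;> linarith
end

section
/- Let G be a Herglotz function and let A ⊆ ℝ be a Borel set with |A| < ∞ such that the boundary value G(t) = lim_{y→0+} G(t+iy) exists and is real for Lebesgue-almost every t ∈ A. Then for every Borel set S ⊆ ℝ, ∫_A ω_{G(t)}(S) dt = |{t ∈ A : G(t) ∈ S}|. -/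
open Filter Topology MeasureTheory Complex

open ProbabilityTheory in
/-- Harmonic measure seen from `z`, as a probability measure on the line. -/
noncomputable def harmonicMeasure (z : ℂ) : Measure ℝ := cauchyMeasure z.re z.im.toNNReal

instance (z : ℂ) : IsProbabilityMeasure (harmonicMeasure z) := by
  unfold harmonicMeasure; infer_instance

lemma pi_inv_mul_im_inv_sub (z : ℂ) (s : ℝ) :
    Real.pi⁻¹ * (((s : ℂ) - z)⁻¹).im = Real.pi⁻¹ * (z.im / ((s - z.re) ^ 2 + z.im ^ 2)) := by
  simp [Complex.inv_im, Complex.normSq_apply, pow_two]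

lemma harmonicMeasure_apply {z : ℂ} (hz : 0 < z.im) {E : Set ℝ} (hE : MeasurableSet E) :
    harmonicMeasure z E
      = ∫⁻ s in E, ENNReal.ofReal (Real.pi⁻¹ * (((s : ℂ) - z)⁻¹).im) := by
  have h0 : z.im.toNNReal ≠ 0 := by simpa using hz
  rw [harmonicMeasure, ProbabilityTheory.cauchyMeasure_of_scale_ne_zero _ h0,
    withDensity_apply _ hE]
  refine lintegral_congr fun s => ?_
  rw [ProbabilityTheory.cauchyPDF_def, ProbabilityTheory.cauchyPDFReal_def,
    pi_inv_mul_im_inv_sub, Real.coe_toNNReal _ hz.le]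
  congr 1
  rw [div_eq_mul_inv, mul_assoc]

lemma harmMeas_eq_real {z : ℂ} (hz : 0 < z.im) {S : Set ℝ} (hS : MeasurableSet S) :
    harmMeas z S = (harmonicMeasure z).real S := by
  rw [measureReal_def, harmonicMeasure_apply hz hS, harmMeas, ← integral_const_mul,
    integral_eq_lintegral_of_nonneg_ae]
  · simp_rw [pi_inv_mul_im_inv_sub, one_div]
  · exact ae_of_all _ fun s => by simp only [Pi.zero_apply]; positivity
  · exact Measurable.aestronglyMeasurable (by fun_prop)

lemma harmonicMeasure_le_of_forall {z w : ℂ} (hz : 0 < z.im) (hw : 0 < w.im) {E : Set ℝ}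
    (hE : MeasurableSet E) {M : ℝ} (hM : 0 ≤ M)
    (h : ∀ s ∈ E, z.im * ‖(s : ℂ) - w‖ ^ 2 ≤ M * (w.im * ‖(s : ℂ) - z‖ ^ 2)) :
    harmonicMeasure z E ≤ ENNReal.ofReal M * harmonicMeasure w E := by
  rw [harmonicMeasure_apply hz hE, harmonicMeasure_apply hw hE,
    ← lintegral_const_mul' _ _ ENNReal.ofReal_ne_top]
  refine setLIntegral_mono' hE fun s hs => ?_
  rw [← ENNReal.ofReal_mul hM]
  refine ENNReal.ofReal_le_ofReal ?_
  have key : ∀ u : ℂ, ((s : ℂ) - u)⁻¹.im = u.im / ‖(s : ℂ) - u‖ ^ 2 := fun u => by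
    simp [Complex.inv_im, ← Complex.normSq_eq_norm_sq]
  have pos : ∀ u : ℂ, 0 < u.im → 0 < ‖(s : ℂ) - u‖ ^ 2 := fun u hu => by
    have : (s : ℂ) - u ≠ 0 := fun h0 => by
      have := congrArg Complex.im h0
      simp at this
      exact hu.ne' this
    positivity
  rw [key, key, mul_left_comm]
  refine mul_le_mul_of_nonneg_left ?_ (by positivity)
  rw [mul_div_assoc', div_le_div_iff₀ (pos z hz) (pos w hw), mul_assoc]
  exact h s hs

lemma tendsto_harmonicMeasure_zero {l : Filter ℝ} {Z : ℝ → ℂ} (hZ : ∀ᶠ y in l, 0 < (Z y).im)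
    {x : ℝ} (hx : Tendsto Z l (𝓝 (x : ℂ))) {C : Set ℝ} (hC : IsClosed C) (hxC : x ∉ C) :
    Tendsto (fun y => harmonicMeasure (Z y) C) l (𝓝 0) := by
  obtain ⟨d, hd, hball⟩ := Metric.isOpen_iff.1 hC.isOpen_compl x hxC
  have hfar : ∀ s ∈ C, d ≤ |s - x| := fun s hs => by
    by_contra! hlt
    exact hball (by rwa [Metric.mem_ball, Real.dist_eq]) hs
  have him : Tendsto (fun y => ENNReal.ofReal (8 * (Z y).im / d)) l (𝓝 0) := by
    have h1 : Tendsto (fun y => (Z y).im) l (𝓝 0) := by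
      simpa [Function.comp_def] using (Complex.continuous_im.tendsto (x : ℂ)).comp hx
    have h2 := ENNReal.tendsto_ofReal ((h1.const_mul 8).div_const d)
    simpa using h2
  refine tendsto_of_tendsto_of_tendsto_of_le_of_le' tendsto_const_nhds him
    (Eventually.of_forall fun _ => zero_le) ?_
  filter_upwards [hZ, hx.eventually (Metric.ball_mem_nhds (x : ℂ) (half_pos hd))] with y hy hyx
  have hw : 0 < ((x : ℂ) + d * I).im := by simpa using hd
  calc harmonicMeasure (Z y) C
      ≤ ENNReal.ofReal (8 * (Z y).im / d) * harmonicMeasure ((x : ℂ) + d * I) C := by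
        refine harmonicMeasure_le_of_forall hy hw hC.measurableSet (by positivity) fun s hs => ?_
        have e1 : ‖(s : ℂ) - (x + d * I)‖ ^ 2 = |s - x| ^ 2 + d ^ 2 := by
          rw [← Complex.normSq_eq_norm_sq, Complex.normSq_apply, sq_abs]
          simp
          ring
        have e2 : |s - x| / 2 ≤ ‖(s : ℂ) - Z y‖ := by
          have h1 : ‖(s : ℂ) - x‖ = |s - x| := by
            rw [← Complex.ofReal_sub, Complex.norm_real, Real.norm_eq_abs]
          have h2 := norm_sub_le_norm_sub_add_norm_sub (s : ℂ) (Z y) x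
          rw [Complex.dist_eq] at hyx
          linarith [hfar s hs]
        have e3 : ((x : ℂ) + d * I).im = d := by simp
        rw [e1, e3]
        have h3 := hfar s hs
        have e4 : |s - x| ^ 2 ≤ 4 * ‖(s : ℂ) - Z y‖ ^ 2 := by nlinarith
        have e5 : |s - x| ^ 2 + d ^ 2 ≤ 8 * ‖(s : ℂ) - Z y‖ ^ 2 := by nlinarith
        calc (Z y).im * (|s - x| ^ 2 + d ^ 2) ≤ (Z y).im * (8 * ‖(s : ℂ) - Z y‖ ^ 2) := by gcongr
          _ = _ := by field_simp
    _ ≤ ENNReal.ofReal (8 * (Z y).im / d) * 1 := by gcongr; exact prob_le_one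
    _ = _ := mul_one _

lemma eventually_harmonicMeasure_le {w : ℂ} (hw : 0 < w.im) :
    ∀ᶠ z in 𝓝 w, ∀ E : Set ℝ, MeasurableSet E →
      harmonicMeasure z E ≤ ENNReal.ofReal 8 * harmonicMeasure w E := by
  filter_upwards [Metric.ball_mem_nhds w (half_pos hw)] with z hz E hE
  rw [Metric.mem_ball, Complex.dist_eq] at hz
  have him : |z.im - w.im| < w.im / 2 := by
    refine lt_of_le_of_lt ?_ hz
    simpa using Complex.abs_im_le_norm (z - w)
  rw [abs_lt] at him
  refine harmonicMeasure_le_of_forall (by linarith) hw hE (by norm_num) fun s _ => ?_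
  have h1 : w.im ≤ ‖(s : ℂ) - w‖ := by
    have := Complex.abs_im_le_norm ((s : ℂ) - w)
    simp at this
    exact (le_abs_self _).trans this
  have h2 := norm_sub_le_norm_sub_add_norm_sub (s : ℂ) z w
  have h3 : ‖(s : ℂ) - w‖ ^ 2 ≤ 4 * ‖(s : ℂ) - z‖ ^ 2 := by
    nlinarith [norm_nonneg ((s : ℂ) - z), norm_nonneg ((s : ℂ) - w)]
  calc z.im * ‖(s : ℂ) - w‖ ^ 2 ≤ (2 * w.im) * (4 * ‖(s : ℂ) - z‖ ^ 2) := by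
        gcongr; linarith
    _ = _ := by ring

/-- The Cayley transform from the unit disc to the upper half plane, sending `0` to `I`. -/
noncomputable def cayley (w : ℂ) : ℂ := I * ((1 - w) / (1 + w))

lemma cayley_im (w : ℂ) : (cayley w).im = (1 - ‖w‖ ^ 2) / ‖1 + w‖ ^ 2 := by
  simp only [cayley, Complex.I_mul_im, Complex.div_re, ← Complex.normSq_eq_norm_sq,
    Complex.normSq_apply]
  simp
  ring

lemma one_add_ne_zero_of_norm_lt {w : ℂ} (hw : ‖w‖ < 1) : 1 + w ≠ 0 := fun h => by
  rw [eq_neg_of_add_eq_zero_right h] at hw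
  simp at hw

lemma cayley_im_pos {w : ℂ} (hw : ‖w‖ < 1) : 0 < (cayley w).im := by
  have := norm_pos_iff.2 (one_add_ne_zero_of_norm_lt hw)
  rw [cayley_im]
  have : 0 < 1 - ‖w‖ ^ 2 := by nlinarith [norm_nonneg w]
  positivity

lemma differentiableAt_cayley {w : ℂ} (hw : 1 + w ≠ 0) : DifferentiableAt ℂ cayley w := by
  unfold cayley
  fun_prop (disch := assumption)

lemma one_add_exp_ne_zero_and_cayley_exp {θ : ℝ} (hθ : θ ∈ Set.Ioo (-Real.pi) Real.pi) :
    1 + exp (θ * I) ≠ 0 ∧ cayley (exp (θ * I)) = (Real.tan (θ / 2) : ℂ) := by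
  have hcos : Real.cos (θ / 2) ≠ 0 :=
    (Real.cos_pos_of_mem_Ioo ⟨by linarith [hθ.1], by linarith [hθ.2]⟩).ne'
  have hcos' : Complex.cos ((θ / 2 : ℝ) : ℂ) ≠ 0 := by exact_mod_cast hcos
  set u : ℂ := ((θ / 2 : ℝ) : ℂ) with hu
  have hθu : (θ : ℂ) * I = u * I + u * I := by rw [hu]; push_cast; ring
  have hsq : Complex.cos u ^ 2 + Complex.sin u ^ 2 = 1 := Complex.cos_sq_add_sin_sq u
  have e1 : 1 + exp (θ * I) = 2 * Complex.cos u * exp (u * I) := by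
    rw [hθu, Complex.exp_add, Complex.exp_mul_I]
    linear_combination (-1 : ℂ) * hsq + Complex.sin u ^ 2 * Complex.I_sq
  have e2 : 1 - exp (θ * I) = -2 * I * Complex.sin u * exp (u * I) := by
    rw [hθu, Complex.exp_add, Complex.exp_mul_I]
    linear_combination (-1 : ℂ) * hsq + Complex.sin u ^ 2 * Complex.I_sq
  have hne := Complex.exp_ne_zero (u * I)
  refine ⟨by rw [e1]; exact mul_ne_zero (mul_ne_zero two_ne_zero hcos') hne, ?_⟩
  rw [cayley, e1, e2, Complex.ofReal_tan, ← hu, Complex.tan]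
  field_simp
  linear_combination -Complex.sin u * Complex.I_sq

/-- The mean value inequality on circles, pushed to the boundary of the disc. -/
lemma lintegral_im_tan_half_le {F : ℂ → ℂ} {δ : ℝ} (hδ : 0 < δ)
    (hF : DifferentiableOn ℂ F {z | -δ < z.im}) (hpos : ∀ z : ℂ, -δ < z.im → 0 ≤ (F z).im) :
    ∫⁻ θ in Set.Ioo (-Real.pi) Real.pi, ENNReal.ofReal (F (Real.tan (θ / 2))).im
      ≤ ENNReal.ofReal (2 * Real.pi * (F I).im) := by
  have hopen : IsOpen {z : ℂ | -δ < z.im} := isOpen_lt continuous_const Complex.continuous_im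
  have hFat : ∀ z : ℂ, -δ < z.im → DifferentiableAt ℂ F z := fun z hz =>
    hF.differentiableAt (hopen.mem_nhds hz)
  set r : ℕ → ℝ := fun n => 1 - 1 / ((n : ℝ) + 2) with hr
  have hr0 : ∀ n, 0 < r n ∧ r n < 1 := fun n => by
    have h2 : (0 : ℝ) < (n : ℝ) + 2 := by positivity
    have : 1 / ((n : ℝ) + 2) < 1 := by rw [div_lt_one h2]; linarith [(n.cast_nonneg : (0 : ℝ) ≤ n)]
    have : 0 < 1 / ((n : ℝ) + 2) := by positivity
    exact ⟨by simp only [hr]; linarith, by simp only [hr]; linarith⟩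
  have hrlim : Tendsto r atTop (𝓝 1) := by
    have : Tendsto (fun n : ℕ => 1 / ((n : ℝ) + 2)) atTop (𝓝 0) := by
      simp_rw [one_div]
      exact tendsto_inv_atTop_zero.comp
        (tendsto_atTop_add_const_right _ _ tendsto_natCast_atTop_atTop)
    simpa [hr] using this.const_sub 1
  have hnorm : ∀ n (θ : ℝ), ‖circleMap 0 (r n) θ‖ < 1 := fun n θ => by
    simpa [abs_of_pos (hr0 n).1] using (hr0 n).2
  have hdiff : ∀ w : ℂ, ‖w‖ < 1 → DifferentiableAt ℂ (F ∘ cayley) w := fun w hw =>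
    (hFat _ (by linarith [cayley_im_pos hw])).comp w
      (differentiableAt_cayley (one_add_ne_zero_of_norm_lt hw))
  have hcont : ∀ n, Continuous fun θ : ℝ => F (cayley (circleMap 0 (r n) θ)) := fun n =>
    continuous_iff_continuousAt.2 fun θ =>
      ContinuousAt.comp (f := circleMap 0 (r n)) (hdiff _ (hnorm n θ)).continuousAt
        (continuous_circleMap 0 (r n)).continuousAt
  have hmean : ∀ n, ∫⁻ θ in Set.Ioo (-Real.pi) Real.pi,
      ENNReal.ofReal (F (cayley (circleMap 0 (r n) θ))).im
        = ENNReal.ofReal (2 * Real.pi * (F I).im) := fun n => by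
    have hav : Real.circleAverage (F ∘ cayley) 0 (r n) = F I := by
      have hd : DiffContOnCl ℂ (F ∘ cayley) (Metric.ball 0 |r n|) := by
        refine DifferentiableOn.diffContOnCl fun w hw => (hdiff w ?_).differentiableWithinAt
        have := Metric.closure_ball_subset_closedBall hw
        rw [mem_closedBall_zero_iff, abs_of_pos (hr0 n).1] at this
        exact this.trans_lt (hr0 n).2
      rw [hd.circleAverage]
      simp [cayley]
    have hper : Function.Periodic (fun θ : ℝ => F (cayley (circleMap 0 (r n) θ)))
        (2 * Real.pi) := (periodic_circleMap 0 (r n)).comp (F ∘ cayley)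
    have hint : ∫ θ in (-Real.pi)..Real.pi, F (cayley (circleMap 0 (r n) θ))
        = 2 * Real.pi * F I := by
      have h1 := hper.intervalIntegral_add_eq (-Real.pi) 0
      rw [show -Real.pi + 2 * Real.pi = Real.pi by ring, zero_add] at h1
      rw [h1, ← hav, Real.circleAverage_def]
      have : (Real.pi : ℂ) ≠ 0 := by exact_mod_cast Real.pi_ne_zero
      simp only [Function.comp_apply, Complex.real_smul]
      push_cast
      field_simp
    rw [intervalIntegral.integral_of_le (by linarith [Real.pi_pos]), integral_Ioc_eq_integral_Ioo]
      at hint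
    have hI : Integrable (fun θ : ℝ => F (cayley (circleMap 0 (r n) θ)))
        (volume.restrict (Set.Ioo (-Real.pi) Real.pi)) :=
      ((hcont n).integrableOn_Icc (a := -Real.pi) (b := Real.pi)).mono_set
        Set.Ioo_subset_Icc_self
    rw [← ofReal_integral_eq_lintegral_ofReal]
    · congr 1
      have h2 := integral_im (𝕜 := ℂ) hI
      simp only [RCLike.im_to_complex] at h2
      rw [h2, hint]
      simp
    · exact hI.im
    · exact ae_of_all _ fun θ => hpos _ (by linarith [cayley_im_pos (hnorm n θ)])
  calc ∫⁻ θ in Set.Ioo (-Real.pi) Real.pi, ENNReal.ofReal (F (Real.tan (θ / 2))).im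
      = ∫⁻ θ in Set.Ioo (-Real.pi) Real.pi, liminf (fun n =>
          ENNReal.ofReal (F (cayley (circleMap 0 (r n) θ))).im) atTop := by
        refine setLIntegral_congr_fun measurableSet_Ioo fun θ hθ => ?_
        obtain ⟨hne, hc⟩ := one_add_exp_ne_zero_and_cayley_exp hθ
        have h1 : Tendsto (fun n => circleMap 0 (r n) θ) atTop (𝓝 (exp (θ * I))) := by
          have h := ((Complex.continuous_ofReal.tendsto 1).comp hrlim).mul_const (exp (θ * I))
          simpa [circleMap] using h
        have h2 : Tendsto (fun n => cayley (circleMap 0 (r n) θ)) atTop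
            (𝓝 (Real.tan (θ / 2) : ℂ)) :=
          hc ▸ (differentiableAt_cayley hne).continuousAt.tendsto.comp h1
        have h3 := (hFat (Real.tan (θ / 2) : ℂ) (by rw [Complex.ofReal_im]; linarith)).continuousAt.tendsto.comp h2
        exact (ENNReal.tendsto_ofReal
          ((Complex.continuous_im.tendsto _).comp h3)).liminf_eq.symm
    _ ≤ liminf (fun n => ∫⁻ θ in Set.Ioo (-Real.pi) Real.pi,
          ENNReal.ofReal (F (cayley (circleMap 0 (r n) θ))).im) atTop :=
        lintegral_liminf_le fun n =>
          (Complex.continuous_im.comp (hcont n)).measurable.ennreal_ofReal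
    _ = _ := by simp_rw [hmean]; exact liminf_const _

lemma lintegral_cauchyPDF_mul_im_le {F : ℂ → ℂ} {δ : ℝ} (hδ : 0 < δ)
    (hF : DifferentiableOn ℂ F {z | -δ < z.im}) (hpos : ∀ z : ℂ, -δ < z.im → 0 ≤ (F z).im) :
    ∫⁻ t : ℝ, ProbabilityTheory.cauchyPDF 0 1 t * ENNReal.ofReal (F t).im
      ≤ ENNReal.ofReal (F I).im := by
  have himg : (fun t : ℝ => 2 * Real.arctan t) '' Set.univ = Set.Ioo (-Real.pi) Real.pi := by
    ext θ
    constructor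
    · rintro ⟨t, -, rfl⟩
      exact ⟨by linarith [Real.neg_pi_div_two_lt_arctan t],
        by linarith [Real.arctan_lt_pi_div_two t]⟩
    · rintro ⟨h1, h2⟩
      refine ⟨Real.tan (θ / 2), trivial, ?_⟩
      simp only
      rw [Real.arctan_tan (by linarith) (by linarith)]
      ring
  have hcv := lintegral_image_eq_lintegral_abs_deriv_mul (s := Set.univ)
    (f := fun t : ℝ => 2 * Real.arctan t) (f' := fun t => 2 * (1 / (1 + t ^ 2))) MeasurableSet.univ
    (fun t _ => ((Real.hasDerivAt_arctan t).const_mul 2).hasDerivWithinAt)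
    (fun a _ b _ hab => Real.arctan_injective (by simpa using hab))
    (fun θ => ENNReal.ofReal (F (Real.tan (θ / 2))).im)
  have hle := lintegral_im_tan_half_le hδ hF hpos
  rw [himg] at hcv
  rw [hcv, Measure.restrict_univ] at hle
  have h2pi : (0 : ℝ) ≤ (2 * Real.pi)⁻¹ := by positivity
  calc ∫⁻ t : ℝ, ProbabilityTheory.cauchyPDF 0 1 t * ENNReal.ofReal (F t).im
      = ENNReal.ofReal (2 * Real.pi)⁻¹ * ∫⁻ t : ℝ, ENNReal.ofReal |2 * (1 / (1 + t ^ 2))| *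
          ENNReal.ofReal (F (Real.tan (2 * Real.arctan t / 2))).im := by
        rw [← lintegral_const_mul' _ _ ENNReal.ofReal_ne_top]
        refine lintegral_congr fun t => ?_
        rw [← mul_assoc, ← ENNReal.ofReal_mul h2pi, mul_div_cancel_left₀ _ (two_ne_zero' ℝ),
          Real.tan_arctan, ProbabilityTheory.cauchyPDF_def, ProbabilityTheory.cauchyPDFReal_def]
        congr 2
        rw [abs_of_pos (by positivity)]
        simp
        rw [add_comm]
        field_simp
    _ ≤ ENNReal.ofReal (2 * Real.pi)⁻¹ * ENNReal.ofReal (2 * Real.pi * (F I).im) := by gcongr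
    _ = _ := by
        rw [← ENNReal.ofReal_mul h2pi]
        congr 1
        field_simp

lemma IsHerglotz.continuous_shift {G : ℂ → ℂ} (hG : IsHerglotz G) {y : ℝ} (hy : 0 < y) :
    Continuous fun t : ℝ => G (t + y * I) := by
  refine continuous_iff_continuousAt.2 fun t => ?_
  have hopen : IsOpen {z : ℂ | 0 < z.im} := isOpen_lt continuous_const Complex.continuous_im
  have h1 : ContinuousAt G (t + y * I) :=
    (hG.1.differentiableAt (hopen.mem_nhds (by simpa using hy))).continuousAt
  exact ContinuousAt.comp (f := fun t : ℝ => (t : ℂ) + y * I) h1 (by fun_prop)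

lemma IsHerglotz.im_shift_pos {G : ℂ → ℂ} (hG : IsHerglotz G) {y : ℝ} (hy : 0 < y) (t : ℝ) :
    0 < (G (t + y * I)).im := hG.2 _ (by simpa using hy)

lemma IsHerglotz.measurable_kernel {G : ℂ → ℂ} (hG : IsHerglotz G) {y : ℝ} (hy : 0 < y) :
    Measurable fun p : ℝ × ℝ =>
      ENNReal.ofReal (Real.pi⁻¹ * (((p.2 : ℂ) - G (p.1 + y * I))⁻¹).im) := by
  have h1 : Measurable fun p : ℝ × ℝ => G (p.1 + y * I) :=
    (hG.continuous_shift hy).measurable.comp measurable_fst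
  have h2 : Measurable fun p : ℝ × ℝ => ((p.2 : ℂ) - G (p.1 + y * I))⁻¹ :=
    ((Complex.measurable_ofReal.comp measurable_snd).sub h1).inv
  exact ((Complex.measurable_im.comp h2).const_mul _).ennreal_ofReal

lemma IsHerglotz.measurable_harmonicMeasure {G : ℂ → ℂ} (hG : IsHerglotz G) {y : ℝ} (hy : 0 < y)
    {E : Set ℝ} (hE : MeasurableSet E) :
    Measurable fun t : ℝ => harmonicMeasure (G (t + y * I)) E := by
  simp_rw [fun t : ℝ => harmonicMeasure_apply (hG.im_shift_pos hy t) hE]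
  exact (hG.measurable_kernel hy).lintegral_prod_right'

lemma IsHerglotz.lintegral_harmonicMeasure_le {G : ℂ → ℂ} (hG : IsHerglotz G) {y : ℝ}
    (hy : 0 < y) {E : Set ℝ} (hE : MeasurableSet E) :
    ∫⁻ t : ℝ, ProbabilityTheory.cauchyPDF 0 1 t * harmonicMeasure (G (t + y * I)) E
      ≤ harmonicMeasure (G (I + y * I)) E := by
  have hi : 0 < (G (I + y * I)).im := hG.2 _ (by simp; linarith)
  simp_rw [fun t : ℝ => harmonicMeasure_apply (hG.im_shift_pos hy t) hE]
  rw [harmonicMeasure_apply hi hE]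
  have hcomm : ∫⁻ t : ℝ, ProbabilityTheory.cauchyPDF 0 1 t *
        ∫⁻ s in E, ENNReal.ofReal (Real.pi⁻¹ * (((s : ℂ) - G (t + y * I))⁻¹).im)
      = ∫⁻ s in E, ∫⁻ t : ℝ, ProbabilityTheory.cauchyPDF 0 1 t *
          ENNReal.ofReal (Real.pi⁻¹ * (((s : ℂ) - G (t + y * I))⁻¹).im) := by
    rw [← lintegral_lintegral_swap]
    · refine lintegral_congr fun t => ?_
      rw [lintegral_const_mul' _ _ (by simp [ProbabilityTheory.cauchyPDF_def])]
    · have h1 := hG.measurable_kernel hy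
      have h2 : Measurable fun p : ℝ × ℝ => ProbabilityTheory.cauchyPDF 0 1 p.1 :=
        (ProbabilityTheory.measurable_cauchyPDF 0 1).comp measurable_fst
      exact (Measurable.mul h2 h1).aemeasurable
  rw [hcomm]
  refine lintegral_mono fun s => ?_
  have him : ∀ z : ℂ, -y < z.im → 0 < (G (z + y * I)).im := fun z hz =>
    hG.2 _ (by simp; linarith)
  have hne : ∀ z : ℂ, -y < z.im → (s : ℂ) - G (z + y * I) ≠ 0 := fun z hz h0 => by
    have := congrArg Complex.im h0
    simp at this
    exact (him z hz).ne' this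
  have hF : DifferentiableOn ℂ (fun z : ℂ => (Real.pi⁻¹ : ℝ) * ((s : ℂ) - G (z + y * I))⁻¹)
      {z | -y < z.im} := by
    have h1 : DifferentiableOn ℂ (fun z : ℂ => G (z + y * I)) {z | -y < z.im} :=
      hG.1.comp (by fun_prop) fun z (hz : -y < z.im) => by
        simp only [Set.mem_ofPred_eq]; simp; linarith
    exact (((differentiableOn_const _).sub h1).inv fun z hz => hne z hz).const_mul _
  have := lintegral_cauchyPDF_mul_im_le hy hF fun z hz => by
    rw [Complex.im_ofReal_mul, pi_inv_mul_im_inv_sub]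
    have := him z hz
    positivity
  simpa only [Complex.im_ofReal_mul] using this

lemma le_liminf_of_subset_union {ν : ℕ → Measure ℝ} {T E C : Set ℝ} {a : ENNReal}
    (hsub : T ⊆ E ∪ C) (hT : Tendsto (fun n => ν n T) atTop (𝓝 a)) (ha : a ≠ ⊤)
    (hC : Tendsto (fun n => ν n C) atTop (𝓝 0)) :
    a ≤ liminf (fun n => ν n E) atTop := by
  have h1 : Tendsto (fun n => ν n T - ν n C) atTop (𝓝 a) := by
    simpa using ENNReal.Tendsto.sub hT hC (Or.inl ha)
  rw [← h1.liminf_eq]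
  refine liminf_le_liminf (Eventually.of_forall fun n => ?_)
  exact tsub_le_iff_right.2 ((measure_mono hsub).trans (measure_union_le _ _))

lemma exists_closed_open_measure_sdiff_le (μ : Measure ℝ) [IsFiniteMeasure μ] {S : Set ℝ}
    (hS : MeasurableSet S) {ε : ENNReal} (hε : ε ≠ 0) :
    ∃ K U, IsClosed K ∧ IsOpen U ∧ K ⊆ S ∧ S ⊆ U ∧ μ (U \ K) ≤ ε := by
  have hε2 : ε / 2 ≠ 0 := (ENNReal.half_pos hε).ne'
  obtain ⟨K, hKS, hK, hKlt⟩ := hS.exists_isClosed_sdiff_lt (measure_ne_top μ S) hε2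
  obtain ⟨U, hSU, hU, -, hUlt⟩ := hS.exists_isOpen_sdiff_lt (measure_ne_top μ S) hε2
  refine ⟨K, U, hK, hU, hKS, hSU, ?_⟩
  calc μ (U \ K) ≤ μ ((U \ S) ∪ (S \ K)) := measure_mono fun x hx => by
        by_cases hxS : x ∈ S
        · exact Or.inr ⟨hxS, hx.2⟩
        · exact Or.inl ⟨hx.1, hxS⟩
    _ ≤ μ (U \ S) + μ (S \ K) := measure_union_le _ _
    _ ≤ ε / 2 + ε / 2 := add_le_add hUlt.le hKlt.le
    _ = ε := ENNReal.add_halves ε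

/-- The boundary values of `ω_G(S)` agree almost everywhere on `A` with the indicator of
`{G ∈ S}`. -/
lemma IsHerglotz.ae_eq_indicator {G : ℂ → ℂ} (hG : IsHerglotz G) {A : Set ℝ} {g : ℝ → ℝ}
    (hbdry : ∀ᵐ t : ℝ ∂(volume.restrict A),
      Tendsto (fun y : ℝ => G (t + y * I)) (𝓝[>] 0) (𝓝 ((g t : ℝ) : ℂ)))
    {S : Set ℝ} (hS : MeasurableSet S) {h : ℝ → ℝ}
    (hh : ∀ᵐ t : ℝ ∂(volume.restrict A),
      Tendsto (fun y : ℝ => harmMeas (G (t + y * I)) S) (𝓝[>] 0) (𝓝 (h t))) :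
    ∀ᵐ t : ℝ ∂(volume.restrict A), h t = S.indicator 1 (g t) := by
  have hi : 0 < (G I).im := hG.2 _ (by simp)
  set y : ℕ → ℝ := fun n => 1 / ((n : ℝ) + 1) with hydef
  have hy : ∀ n, 0 < y n := fun n => by simp only [hydef]; positivity
  have hylim : Tendsto y atTop (𝓝[>] 0) :=
    tendsto_nhdsWithin_iff.2 ⟨tendsto_one_div_add_atTop_nhds_zero_nat, Eventually.of_forall hy⟩
  choose K U hK hU hKS hSU hUK using fun k : ℕ =>
    exists_closed_open_measure_sdiff_le (harmonicMeasure (G I)) hS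
      (ε := ((k : ENNReal) + 1)⁻¹) (by simp)
  have hE : ∀ k, MeasurableSet (U k \ K k) := fun k =>
    (hU k).measurableSet.diff (hK k).measurableSet
  set f : ℕ → ℝ → ENNReal := fun k t =>
    liminf (fun n => harmonicMeasure (G (t + y n * I)) (U k \ K k)) atTop with hf
  have hfm : ∀ k, Measurable (f k) := fun k =>
    Measurable.liminf fun n => hG.measurable_harmonicMeasure (hy n) (hE k)
  have hfint : ∀ k, ∫⁻ t, ProbabilityTheory.cauchyPDF 0 1 t * f k t
      ≤ ENNReal.ofReal 8 * ((k : ENNReal) + 1)⁻¹ := fun k => by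
    have hcont : Tendsto (fun n => G (I + y n * I)) atTop (𝓝 (G I)) := by
      have hopen : IsOpen {z : ℂ | 0 < z.im} := isOpen_lt continuous_const Complex.continuous_im
      have h1 : ContinuousAt G I :=
        (hG.1.differentiableAt (hopen.mem_nhds (by simp))).continuousAt
      refine h1.tendsto.comp ?_
      have h2 : Tendsto (fun n => ((y n : ℝ) : ℂ)) atTop (𝓝 ((0 : ℝ) : ℂ)) :=
        (Complex.continuous_ofReal.tendsto 0).comp (tendsto_nhdsWithin_iff.1 hylim).1
      simpa using (h2.mul_const I).const_add I
    calc ∫⁻ t, ProbabilityTheory.cauchyPDF 0 1 t * f k t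
        = ∫⁻ t : ℝ, liminf (fun n => ProbabilityTheory.cauchyPDF 0 1 t *
            harmonicMeasure (G (t + y n * I)) (U k \ K k)) atTop := by
          refine lintegral_congr fun t => ?_
          exact (ENNReal.liminf_const_mul_of_ne_top
            (by simp [ProbabilityTheory.cauchyPDF_def])).symm
      _ ≤ liminf (fun n => ∫⁻ t : ℝ, ProbabilityTheory.cauchyPDF 0 1 t *
            harmonicMeasure (G (t + y n * I)) (U k \ K k)) atTop :=
          lintegral_liminf_le fun n => (ProbabilityTheory.measurable_cauchyPDF 0 1).mul
            (hG.measurable_harmonicMeasure (hy n) (hE k))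
      _ ≤ liminf (fun _ : ℕ => ENNReal.ofReal 8 * ((k : ENNReal) + 1)⁻¹) atTop := by
          refine liminf_le_liminf ?_
          filter_upwards [hcont.eventually (eventually_harmonicMeasure_le hi)] with n hn
          calc _ ≤ _ := hG.lintegral_harmonicMeasure_le (hy n) (hE k)
            _ ≤ _ := hn _ (hE k)
            _ ≤ _ := by gcongr; exact hUK k
      _ = _ := liminf_const _
  have hinf : ∀ᵐ t : ℝ, ⨅ k, f k t = 0 := by
    have hzero : ∫⁻ t, ProbabilityTheory.cauchyPDF 0 1 t * ⨅ k, f k t = 0 := by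
      have hlim : Tendsto (fun k : ℕ => ENNReal.ofReal 8 * ((k : ENNReal) + 1)⁻¹) atTop (𝓝 0) := by
        have h1 : Tendsto (fun k : ℕ => ((k : ENNReal) + 1)⁻¹) atTop (𝓝 0) := by
          simpa using (tendsto_add_atTop_iff_nat 1).2 ENNReal.tendsto_inv_nat_nhds_zero
        have h2 := ENNReal.Tendsto.const_mul (a := ENNReal.ofReal 8) h1
          (Or.inr ENNReal.ofReal_ne_top)
        rwa [mul_zero] at h2
      refine le_antisymm (ge_of_tendsto' hlim fun k => ?_) zero_le
      refine (lintegral_mono fun t => ?_).trans (hfint k)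
      gcongr
      exact iInf_le _ k
    have hae := (lintegral_eq_zero_iff ((ProbabilityTheory.measurable_cauchyPDF 0 1).mul
      (Measurable.iInf hfm))).1 hzero
    filter_upwards [hae] with t ht
    refine (mul_eq_zero.1 ht).resolve_left ?_
    have := ProbabilityTheory.cauchyPDF_pos 0 one_ne_zero t
    simpa [ProbabilityTheory.cauchyPDF_def] using this
  filter_upwards [hbdry, hh, ae_restrict_of_ae hinf] with t hgt hht hft
  have hpos : ∀ᶠ u : ℝ in 𝓝[>] 0, 0 < (G (t + u * I)).im := by
    filter_upwards [self_mem_nhdsWithin] with u hu using hG.im_shift_pos hu t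
  have hreal : Tendsto (fun n => (harmonicMeasure (G (t + y n * I))).real S) atTop (𝓝 (h t)) := by
    refine (hht.comp hylim).congr fun n => ?_
    exact harmMeas_eq_real (hG.im_shift_pos (hy n) t) hS
  by_cases hgS : g t ∈ S
  · have hcompl : Tendsto (fun n => harmonicMeasure (G (t + y n * I)) Sᶜ) atTop
        (𝓝 (ENNReal.ofReal (1 - h t))) := by
      refine (ENNReal.tendsto_ofReal (hreal.const_sub 1)).congr fun n => ?_
      rw [← probReal_compl_eq_one_sub hS, ofReal_measureReal]
    have hle : ENNReal.ofReal (1 - h t) ≤ ⨅ k, f k t := le_iInf fun k =>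
      le_liminf_of_subset_union (C := (U k)ᶜ)
        (fun x hx => by
          by_cases hxU : x ∈ U k
          · exact Or.inl ⟨hxU, fun hxK => hx (hKS k hxK)⟩
          · exact Or.inr hxU) hcompl ENNReal.ofReal_ne_top
        ((tendsto_harmonicMeasure_zero hpos hgt (hU k).isClosed_compl
          (fun hn => hn (hSU k hgS))).comp hylim)
    rw [hft, nonpos_iff_eq_zero, ENNReal.ofReal_eq_zero] at hle
    have hle1 : h t ≤ 1 := le_of_tendsto' hreal fun n => measureReal_le_one
    rw [Set.indicator_of_mem hgS, Pi.one_apply]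
    linarith
  · have hlim : Tendsto (fun n => harmonicMeasure (G (t + y n * I)) S) atTop
        (𝓝 (ENNReal.ofReal (h t))) := by
      refine (ENNReal.tendsto_ofReal hreal).congr fun n => ?_
      rw [ofReal_measureReal]
    have hle : ENNReal.ofReal (h t) ≤ ⨅ k, f k t := le_iInf fun k =>
      le_liminf_of_subset_union (C := K k)
        (fun x hx => by
          by_cases hxK : x ∈ K k
          · exact Or.inr hxK
          · exact Or.inl ⟨hSU k hx, hxK⟩) hlim ENNReal.ofReal_ne_top
        ((tendsto_harmonicMeasure_zero hpos hgt (hK k)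
          (fun hn => hgS (hKS k hn))).comp hylim)
    rw [hft, nonpos_iff_eq_zero, ENNReal.ofReal_eq_zero] at hle
    have hge : 0 ≤ h t := ge_of_tendsto' hreal fun n => measureReal_nonneg
    rw [Set.indicator_of_notMem hgS]
    linarith

lemma IsHerglotz.aemeasurable_boundary {G : ℂ → ℂ} (hG : IsHerglotz G) {μ : Measure ℝ}
    {g : ℝ → ℝ} (hbdry : ∀ᵐ t : ℝ ∂μ,
      Tendsto (fun y : ℝ => G (t + y * I)) (𝓝[>] 0) (𝓝 ((g t : ℝ) : ℂ))) :
    AEMeasurable g μ := by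
  have hylim : Tendsto (fun n : ℕ => 1 / ((n : ℝ) + 1)) atTop (𝓝[>] 0) :=
    tendsto_nhdsWithin_iff.2 ⟨tendsto_one_div_add_atTop_nhds_zero_nat,
      Eventually.of_forall fun n => by simp only [Set.mem_Ioi]; positivity⟩
  refine aemeasurable_of_tendsto_metrizable_ae' (f := fun (n : ℕ) (t : ℝ) =>
    (G (t + ((1 / ((n : ℝ) + 1) : ℝ) : ℂ) * I)).re) (fun n => ?_) ?_
  · exact (Complex.continuous_re.comp
      (hG.continuous_shift (by positivity))).measurable.aemeasurable
  · filter_upwards [hbdry] with t ht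
    simpa only [Complex.ofReal_re, Function.comp_def] using
      ((Complex.continuous_re.tendsto _).comp ht).comp hylim

theorem stmt9 (G : ℂ → ℂ) (hG : IsHerglotz G)
    (A : Set ℝ) (hA : MeasurableSet A) (hAfin : MeasureTheory.volume A < ⊤)
    -- the boundary value G(t) exists and is real (equal to g t) for a.e. t ∈ A
    (g : ℝ → ℝ)
    (hbdry : ∀ᵐ t : ℝ ∂(MeasureTheory.volume.restrict A),
      Tendsto (fun y : ℝ => G (t + y * Complex.I)) (𝓝[>] 0) (𝓝 ((g t : ℝ) : ℂ)))
    (S : Set ℝ) (hS : MeasurableSet S)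
    -- h is the a.e. boundary value t ↦ ω_{G(t)}(S) on A
    (h : ℝ → ℝ)
    (hh : ∀ᵐ t : ℝ ∂(MeasureTheory.volume.restrict A),
      Tendsto (fun y : ℝ => harmMeas (G (t + y * Complex.I)) S) (𝓝[>] 0) (𝓝 (h t))) :
    ∫ t in A, h t = (MeasureTheory.volume {t ∈ A | g t ∈ S}).toReal := by
  have hg : AEMeasurable g (volume.restrict A) := hG.aemeasurable_boundary hbdry
  calc ∫ t in A, h t = ∫ t in A, S.indicator (1 : ℝ → ℝ) (g t) :=
        integral_congr_ae (hG.ae_eq_indicator hbdry hS hh)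
    _ = ∫ t in A, (hg.mk g ⁻¹' S).indicator 1 t := by
        refine integral_congr_ae ?_
        filter_upwards [hg.ae_eq_mk] with t ht
        rw [ht]
        rfl
    _ = (volume.restrict A (hg.mk g ⁻¹' S)).toReal := by
        rw [integral_indicator_one (hg.measurable_mk hS), measureReal_def]
    _ = (volume {t ∈ A | g t ∈ S}).toReal := by
        congr 1
        have hset : {t ∈ A | g t ∈ S} = g ⁻¹' S ∩ A := Set.inter_comm _ _
        rw [hset, ← Measure.restrict_apply' hA]
        refine measure_congr ?_
        filter_upwards [hg.ae_eq_mk] with t ht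
        exact congrArg (· ∈ S) ht.symm
end

section
/- Let A ⊆ ℝ be a Borel set with |A| > 0, and let F₊ and F₋ be Herglotz functions whose boundary values F_±(t) = lim_{y→0+} F_±(t+iy) exist for Lebesgue-almost every t ∈ A and satisfy F₊(t) = −conj(F₋(t)) for almost every t ∈ A. Then Im F₊(t) > 0 (equivalently Im F₋(t) > 0) for Lebesgue-almost every t ∈ A. -/
open Filter Topology MeasureTheory Complex

lemma upperHalfPlane_continuous_line {f : ℂ → ℂ} (hf : DifferentiableOn ℂ f {z : ℂ | 0 < z.im})
    {y : ℝ} (hy : 0 < y) : Continuous fun t : ℝ => f (t + y * I) := by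
  refine hf.continuousOn.comp_continuous (by fun_prop) fun t => ?_
  simpa using hy

lemma upperHalfPlane_aestronglyMeasurable_vertical {f : ℂ → ℂ}
    (hf : DifferentiableOn ℂ f {z : ℂ | 0 < z.im}) (c : ℝ) :
    AEStronglyMeasurable (fun τ : ℝ => f (c + τ * I)) (volume.restrict (Set.Ioc 0 1)) := by
  refine ContinuousOn.aestronglyMeasurable ?_ measurableSet_Ioc
  refine hf.continuousOn.comp (by fun_prop) fun τ hτ => ?_
  simpa using hτ.1

lemma upperHalfPlane_ae_norm_vertical_le {f : ℂ → ℂ} (hb : ∀ z : ℂ, 0 < z.im → ‖f z‖ ≤ 1) (c : ℝ) :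
    ∀ᵐ τ : ℝ ∂(volume.restrict (Set.Ioc (0 : ℝ) 1)), ‖f (c + τ * I)‖ ≤ 1 := by
  refine (ae_restrict_iff' measurableSet_Ioc).2 (.of_forall fun τ hτ => hb _ ?_)
  simpa using hτ.1

lemma upperHalfPlane_tendsto_integral_vertical {f : ℂ → ℂ}
    (hf : DifferentiableOn ℂ f {z : ℂ | 0 < z.im}) (hb : ∀ z : ℂ, 0 < z.im → ‖f z‖ ≤ 1) (c : ℝ)
    {y : ℕ → ℝ} (hy1 : ∀ n, y n ≤ 1) (hy0 : ∀ n, 0 < y n) (hy : Tendsto y atTop (𝓝 0)) :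
    Tendsto (fun n => ∫ τ in (y n)..1, f (c + τ * I)) atTop (𝓝 (∫ τ in (0 : ℝ)..1, f (c + τ * I))) := by
  have hint : IntervalIntegrable (fun τ : ℝ => f (c + τ * I)) volume 0 1 := by
    rw [intervalIntegrable_iff_integrableOn_Ioc_of_le zero_le_one]
    exact Integrable.of_bound (upperHalfPlane_aestronglyMeasurable_vertical hf c) 1
      (upperHalfPlane_ae_norm_vertical_le hb c)
  have hsub : ∀ n, IntervalIntegrable (fun τ : ℝ => f (c + τ * I)) volume 0 (y n) := fun n =>
    hint.mono_set (Set.uIcc_subset_uIcc_left (by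
      rw [Set.uIcc_of_le zero_le_one]; exact ⟨(hy0 n).le, hy1 n⟩))
  have hrest : Tendsto (fun n => ∫ τ in (0 : ℝ)..(y n), f (c + τ * I)) atTop (𝓝 0) := by
    refine squeeze_zero_norm (fun n => ?_) hy
    have := intervalIntegral.norm_integral_le_of_norm_le_const (a := 0) (b := y n) (C := 1)
      (f := fun τ : ℝ => f (c + τ * I)) (fun τ hτ => hb _ (by
        rw [Set.uIoc_of_le (hy0 n).le] at hτ
        simpa using hτ.1))
    simpa [abs_of_pos (hy0 n)] using this
  have := (tendsto_const_nhds (x := ∫ τ in (0 : ℝ)..1, f (c + τ * I))).sub hrest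
  rw [sub_zero] at this
  refine this.congr fun n => ?_
  rw [intervalIntegral.integral_interval_sub_left hint (hsub n)]

/-- The integral over the top and the sides of a rectangle standing on the real line is bounded by
the measure of the part of its base where the radial limit does not vanish. -/
lemma upperHalfPlane_norm_integral_le {f : ℂ → ℂ}
    (hf : DifferentiableOn ℂ f {z : ℂ | 0 < z.im}) (hb : ∀ z : ℂ, 0 < z.im → ‖f z‖ ≤ 1)
    {a b : ℝ} (hab : a ≤ b) {y : ℕ → ℝ} (hy1 : ∀ n, y n ≤ 1) (hy0 : ∀ n, 0 < y n)
    (hy : Tendsto y atTop (𝓝 0)) {B : Set ℝ} (hB : MeasurableSet B)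
    (hlim : ∀ t ∈ B, Tendsto (fun n => f (t + y n * I)) atTop (𝓝 0)) :
    ‖(∫ t in a..b, f (t + (1 : ℝ) * I)) - I • (∫ τ in (0 : ℝ)..1, f (b + τ * I))
        + I • (∫ τ in (0 : ℝ)..1, f (a + τ * I))‖ ≤ volume.real (Set.Ioc a b \ B) := by
  have hrect : ∀ n, (∫ t in a..b, f (t + (1 : ℝ) * I)) - I • (∫ τ in (y n)..1, f (b + τ * I))
      + I • (∫ τ in (y n)..1, f (a + τ * I)) = ∫ t in a..b, f (t + y n * I) := by
    intro n
    have := integral_boundary_rect_eq_zero_of_differentiableOn f (⟨a, y n⟩ : ℂ) (⟨b, 1⟩ : ℂ)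
      (hf.mono fun z hz => by
        have h2 : z.im ∈ Set.uIcc (y n) 1 := hz.2
        rw [Set.uIcc_of_le (hy1 n)] at h2
        exact (hy0 n).trans_le h2.1)
    simp only at this
    linear_combination -this
  have hL : Tendsto (fun n => ‖∫ t in a..b, f (t + y n * I)‖) atTop
      (𝓝 ‖(∫ t in a..b, f (t + (1 : ℝ) * I)) - I • (∫ τ in (0 : ℝ)..1, f (b + τ * I))
        + I • (∫ τ in (0 : ℝ)..1, f (a + τ * I))‖) := by
    simp_rw [← hrect]
    exact ((tendsto_const_nhds.sub
      ((upperHalfPlane_tendsto_integral_vertical hf hb b hy1 hy0 hy).const_smul I)).add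
      ((upperHalfPlane_tendsto_integral_vertical hf hb a hy1 hy0 hy).const_smul I)).norm
  have hfin : volume (Set.Ioc a b ∩ B) ≠ ⊤ :=
    ((measure_mono Set.inter_subset_left).trans_lt measure_Ioc_lt_top).ne
  have hfin' : volume (Set.Ioc a b \ B) ≠ ⊤ :=
    ((measure_mono Set.sdiff_subset).trans_lt measure_Ioc_lt_top).ne
  have hbd : ∀ n (t : ℝ), ‖f (t + y n * I)‖ ≤ 1 := fun n t => hb _ (by simpa using hy0 n)
  have hR : Tendsto (fun n => (∫ t in Set.Ioc a b ∩ B, ‖f (t + y n * I)‖)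
      + volume.real (Set.Ioc a b \ B)) atTop (𝓝 (volume.real (Set.Ioc a b \ B))) := by
    have : Tendsto (fun n => ∫ t in Set.Ioc a b ∩ B, ‖f (t + y n * I)‖) atTop
        (𝓝 (∫ _t in Set.Ioc a b ∩ B, (0 : ℝ))) := by
      refine tendsto_integral_of_dominated_convergence (fun _ => 1)
        (fun n => (upperHalfPlane_continuous_line hf (hy0 n)).norm.aestronglyMeasurable)
        (integrableOn_const hfin) (fun n => .of_forall fun t => by simpa using hbd n t) ?_
      refine (ae_restrict_iff' (measurableSet_Ioc.inter hB)).2 (.of_forall fun t ht => ?_)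
      simpa using (hlim t ht.2).norm
    simpa using this.add_const (volume.real (Set.Ioc a b \ B))
  refine le_of_tendsto_of_tendsto' hL hR fun n => ?_
  have hcont := upperHalfPlane_continuous_line hf (hy0 n)
  calc ‖∫ t in a..b, f (t + y n * I)‖ ≤ ∫ t in Set.Ioc a b, ‖f (t + y n * I)‖ := by
        rw [intervalIntegral.integral_of_le hab]
        exact norm_integral_le_integral_norm _
    _ = (∫ t in Set.Ioc a b ∩ B, ‖f (t + y n * I)‖) + ∫ t in Set.Ioc a b \ B, ‖f (t + y n * I)‖ :=
        (integral_inter_add_sdiff hB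
          ((hcont.norm.integrableOn_Icc (a := a) (b := b)).mono_set Set.Ioc_subset_Icc_self)).symm
    _ ≤ _ := by
        gcongr
        have := norm_setIntegral_le_of_norm_le_const (f := fun t : ℝ => ‖f (t + y n * I)‖)
          (C := 1) hfin'.lt_top (fun t _ => by simpa using hbd n t)
        simpa using (le_abs_self _).trans this

/-- The radial limit of a Herglotz function along a sequence of heights vanishes only on a null
set. -/
theorem IsHerglotz.volume_tendsto_zero {G : ℂ → ℂ} (hG : IsHerglotz G)
    {y : ℕ → ℝ} (hy1 : ∀ n, y n ≤ 1) (hy0 : ∀ n, 0 < y n) (hy : Tendsto y atTop (𝓝 0)) :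
    volume {t : ℝ | Tendsto (fun n => G (t + y n * I)) atTop (𝓝 0)} = 0 := by
  set B := {t : ℝ | Tendsto (fun n => G (t + y n * I)) atTop (𝓝 0)}
  have hB : MeasurableSet B := measurableSet_tendsto (𝓝 0) fun n =>
    (upperHalfPlane_continuous_line hG.1 (hy0 n)).measurable
  let f : ℕ → ℂ → ℂ := fun k z => G z / (G z + ((1 / ((k : ℝ) + 1) : ℝ) : ℂ) * I)
  have heps : ∀ k : ℕ, (0 : ℝ) < 1 / ((k : ℝ) + 1) := fun k => Nat.one_div_pos_of_nat
  have hden : ∀ (k : ℕ) (z : ℂ), 0 < z.im → G z + ((1 / ((k : ℝ) + 1) : ℝ) : ℂ) * I ≠ 0 := by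
    intro k z hz h
    have h1 := congrArg Complex.im h
    rw [add_im, im_ofReal_mul, I_im, zero_im] at h1
    linarith [hG.2 z hz, heps k]
  have hf : ∀ k, DifferentiableOn ℂ (f k) {z : ℂ | 0 < z.im} := fun k =>
    hG.1.div (hG.1.add_const _) fun z hz => hden k z hz
  have hb : ∀ k (z : ℂ), 0 < z.im → ‖f k z‖ ≤ 1 := by
    intro k z hz
    rw [norm_div]
    refine div_le_one_of_le₀ ?_ (norm_nonneg _)
    rw [← sq_le_sq₀ (norm_nonneg _) (norm_nonneg _), ← normSq_eq_norm_sq, ← normSq_eq_norm_sq,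
      normSq_apply, normSq_apply, add_im, im_ofReal_mul, I_im, add_re, re_ofReal_mul, I_re]
    nlinarith [hG.2 z hz, heps k, mul_pos (hG.2 z hz) (heps k)]
  have hone : ∀ z : ℂ, 0 < z.im → Tendsto (fun k => f k z) atTop (𝓝 1) := by
    intro z hz
    have hne : G z ≠ 0 := fun h => (hG.2 z hz).ne' (by simp [h])
    have h0 : Tendsto (fun k : ℕ => G z + ((1 / ((k : ℝ) + 1) : ℝ) : ℂ) * I) atTop
        (𝓝 (G z + ((0 : ℝ) : ℂ) * I)) :=
      ((continuous_ofReal.tendsto _).comp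
        tendsto_one_div_add_atTop_nhds_zero_nat).mul_const I |>.const_add _
    rw [ofReal_zero, zero_mul, add_zero] at h0
    have := (tendsto_const_nhds (x := G z)).div h0 hne
    rwa [div_self hne] at this
  have hlim : ∀ k, ∀ t ∈ B, Tendsto (fun n => f k (t + y n * I)) atTop (𝓝 0) := by
    intro k t ht
    have h1 : Tendsto (fun n => G (t + y n * I)) atTop (𝓝 0) := ht
    have hne : (0 : ℂ) + ((1 / ((k : ℝ) + 1) : ℝ) : ℂ) * I ≠ 0 := by
      simpa using (ofReal_ne_zero.2 (heps k).ne')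
    have := h1.div (h1.add_const (((1 / ((k : ℝ) + 1) : ℝ) : ℂ) * I)) hne
    rwa [zero_div] at this
  have hvert : ∀ c : ℝ, Tendsto (fun k => ∫ τ in (0 : ℝ)..1, f k (c + τ * I)) atTop (𝓝 1) := by
    intro c
    have : Tendsto (fun k => ∫ τ in (0 : ℝ)..1, f k (c + τ * I)) atTop
        (𝓝 (∫ _τ in (0 : ℝ)..1, (1 : ℂ))) := by
      simp_rw [intervalIntegral.integral_of_le zero_le_one]
      refine tendsto_integral_of_dominated_convergence (fun _ => 1)
        (fun k => upperHalfPlane_aestronglyMeasurable_vertical (hf k) c)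
        (integrableOn_const measure_Ioc_lt_top.ne)
        (fun k => upperHalfPlane_ae_norm_vertical_le (hb k) c) ?_
      refine (ae_restrict_iff' measurableSet_Ioc).2 (.of_forall fun τ hτ => hone _ ?_)
      simpa using hτ.1
    simpa using this
  have hnull : ∀ N : ℕ, volume (Set.Ioc (-N : ℝ) N ∩ B) = 0 := by
    intro N
    have hab : (-N : ℝ) ≤ N := by linarith [N.cast_nonneg (α := ℝ)]
    have htop : Tendsto (fun k => ∫ t in (-N : ℝ)..N, f k (t + (1 : ℝ) * I)) atTop
        (𝓝 (∫ _t in (-N : ℝ)..N, (1 : ℂ))) := by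
      simp_rw [intervalIntegral.integral_of_le hab]
      refine tendsto_integral_of_dominated_convergence (fun _ => 1)
        (fun k => (upperHalfPlane_continuous_line (hf k) one_pos).aestronglyMeasurable)
        (integrableOn_const measure_Ioc_lt_top.ne)
        (fun k => .of_forall fun t => hb k _ (by simp)) (.of_forall fun t => hone _ (by simp))
    have hsum := ((htop.sub ((hvert N).const_smul I)).add ((hvert (-N)).const_smul I)).norm
    have hle := le_of_tendsto' hsum fun k =>
      upperHalfPlane_norm_integral_le (hf k) (hb k) hab hy1 hy0 hy hB (hlim k)
    rw [sub_add_cancel, intervalIntegral.integral_const, norm_smul, norm_one, mul_one,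
      Real.norm_of_nonneg (by linarith)] at hle
    have hsplit := measureReal_inter_add_sdiff (μ := volume) (s := Set.Ioc (-N : ℝ) N) hB
      measure_Ioc_lt_top.ne
    rw [Real.volume_real_Ioc_of_le hab] at hsplit
    have h0 : volume.real (Set.Ioc (-N : ℝ) N ∩ B) = 0 :=
      le_antisymm (by linarith) measureReal_nonneg
    exact (measureReal_eq_zero_iff
      ((measure_mono Set.inter_subset_left).trans_lt measure_Ioc_lt_top).ne).1 h0
  refine measure_mono_null (fun t ht => ?_) (measure_iUnion_null hnull)
  obtain ⟨N, hN⟩ := exists_nat_gt |t|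
  exact Set.mem_iUnion.2 ⟨N, ⟨(abs_lt.1 hN).1, (abs_lt.1 hN).2.le⟩, ht⟩

theorem stmt10 (A : Set ℝ) (hA : MeasurableSet A) (hApos : 0 < MeasureTheory.volume A)
    (Fp Fm : ℂ → ℂ) (hFp : IsHerglotz Fp) (hFm : IsHerglotz Fm)
    -- the boundary values exist a.e. on A
    (fp fm : ℝ → ℂ)
    (hbp : ∀ᵐ t : ℝ ∂(MeasureTheory.volume.restrict A),
      Tendsto (fun y : ℝ => Fp (t + y * Complex.I)) (𝓝[>] 0) (𝓝 (fp t)))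
    (hbm : ∀ᵐ t : ℝ ∂(MeasureTheory.volume.restrict A),
      Tendsto (fun y : ℝ => Fm (t + y * Complex.I)) (𝓝[>] 0) (𝓝 (fm t)))
    -- F₊(t) = −conj(F₋(t)) for a.e. t ∈ A
    (heq : ∀ᵐ t : ℝ ∂(MeasureTheory.volume.restrict A),
      fp t = -(starRingEnd ℂ) (fm t)) :
    ∀ᵐ t : ℝ ∂(MeasureTheory.volume.restrict A), 0 < (fp t).im ∧ 0 < (fm t).im := by
  have hG : IsHerglotz fun z => Fp z + Fm z :=
    ⟨hFp.1.add hFm.1, fun z hz => add_pos (hFp.2 z hz) (hFm.2 z hz)⟩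
  have hypos : ∀ n : ℕ, (0 : ℝ) < 1 / ((n : ℝ) + 1) := fun n => Nat.one_div_pos_of_nat
  have hnull := hG.volume_tendsto_zero (y := fun n : ℕ => 1 / ((n : ℝ) + 1))
    (fun n => by
      rw [div_le_one (by positivity)]
      linarith [n.cast_nonneg (α := ℝ)])
    hypos tendsto_one_div_add_atTop_nhds_zero_nat
  have hae := ae_restrict_of_ae (s := A) (measure_eq_zero_iff_ae_notMem.1 hnull)
  filter_upwards [hbp, hbm, heq, hae] with t hp hm he hn
  have him : (fp t).im = (fm t).im := by simp [he]
  have hnonneg : 0 ≤ (fp t).im := by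
    refine ge_of_tendsto ((continuous_im.tendsto _).comp hp) ?_
    filter_upwards [self_mem_nhdsWithin] with y hy
    exact (hFp.2 _ (by simpa using hy)).le
  have hne : (fp t).im ≠ 0 := by
    intro h0
    refine hn ?_
    have hsum : fp t + fm t = 0 := by
      apply Complex.ext
      · simp [he]
      · simp [← him, h0]
    have hseq : Tendsto (fun n : ℕ => 1 / ((n : ℝ) + 1)) atTop (𝓝[>] 0) :=
      tendsto_nhdsWithin_iff.2 ⟨tendsto_one_div_add_atTop_nhds_zero_nat, .of_forall hypos⟩
    have := (hp.add hm).comp hseq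
    rwa [hsum] at this
  have hpos := lt_of_le_of_ne hnonneg hne.symm
  exact ⟨hpos, him ▸ hpos⟩
end
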